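/- arXiv:2311.06871 — 2 statements merged into one kernel-verified Lean document; each statement's English description precedes it below -/
import Mathlib

section
/- Let {x^k}, {y^k}, {v^k} be generated by Algorithm 1 and suppose Assumption 2 holds. Then there exist a > 0 and k̄₀ ∈ ℕ such that for every k ≥ k̄₀ there is ξ^k ∈ ∇f(y^k − v^k) + ∂g(y^k − v^k) with √2 · ‖ξ^k‖ ≤ a · ‖y^k − x^k‖^{q−1}; equivalently, with Φ(y, v) := F(y − v) and ∂Φ(y, v) := {(ξ, −ξ) : ξ ∈ ∇f(y − v) + ∂g(y − v)}, one has dist(0, ∂Φ(y^k, v^k)) ≤ a ‖y^k − x^k‖^{q−1} for all k ≥ k̄₀. -/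
open Filter Metric Real Set
open scoped InnerProductSpace Topology Pointwise

/-- The convex subdifferential of an extended-real-valued function `g` at `x`. -/
noncomputable def ESubdiff {X : Type*} [NormedAddCommGroup X] [InnerProductSpace ℝ X]
    (g : X → EReal) (x : X) : Set X :=
  {v | ∀ z : X, g x + ((⟪v, z - x⟫_ℝ : ℝ) : EReal) ≤ g z}

/-- First-order Taylor estimate for a vector field whose derivative is Lipschitz on a convex set. -/
theorem norm_sub_sub_fderiv_le {X : Type*} [NormedAddCommGroup X] [InnerProductSpace ℝ X] 
    {f' : X → X} {f'' : X → X →L[ℝ] X} {D : Set X} {K : ℝ}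
    (hD : Convex ℝ D) (hf' : ∀ z ∈ D, HasFDerivAt f' (f'' z) z) (hK : 0 ≤ K)
    (hLip : ∀ a ∈ D, ∀ b ∈ D, ‖f'' a - f'' b‖ ≤ K * ‖a - b‖) {a b : X} (ha : a ∈ D)
    (hb : b ∈ D) : ‖f' b - f' a - f'' a (b - a)‖ ≤ K * ‖b - a‖ ^ 2 := by
  have hconv : Convex ℝ (D ∩ closedBall a ‖b - a‖) := hD.inter (convex_closedBall _ _)
  have h := hconv.norm_image_sub_le_of_norm_hasFDerivWithin_le
    (f := fun u ↦ f' u - f'' a u) (f' := fun u ↦ f'' u - f'' a) (C := K * ‖b - a‖)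
    (x := a) (y := b)
    (fun u hu ↦ ((hf' u hu.1).sub (f'' a).hasFDerivAt).hasFDerivWithinAt)
    (fun u hu ↦ (hLip u hu.1 a ha).trans
      (mul_le_mul_of_nonneg_left (by simpa [dist_eq_norm] using hu.2) hK))
    ⟨ha, by simp⟩ ⟨hb, by simp [dist_eq_norm]⟩
  calc ‖f' b - f' a - f'' a (b - a)‖ = ‖f' b - f'' a b - (f' a - f'' a a)‖ := by
        rw [map_sub]; congr 1; abel
    _ ≤ _ := h
    _ = _ := by ring

/-- Second-order Taylor estimate for a function whose Hessian is Lipschitz on a convex set. -/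
theorem sub_quadratic_model_le {X : Type*} [NormedAddCommGroup X] [InnerProductSpace ℝ X] 
    [CompleteSpace X] {f : X → ℝ} {f' : X → X} {f'' : X → X →L[ℝ] X} {D : Set X} {K : ℝ} (hD : Convex ℝ D) (hf : ∀ z ∈ D, HasGradientAt f (f' z) z)
    (hf' : ∀ z ∈ D, HasFDerivAt f' (f'' z) z) (hK : 0 ≤ K)
    (hLip : ∀ a ∈ D, ∀ b ∈ D, ‖f'' a - f'' b‖ ≤ K * ‖a - b‖) {a b : X} (ha : a ∈ D)
    (hb : b ∈ D) :
    f b - (f a + ⟪f' a, b - a⟫_ℝ + 1 / 2 * ⟪b - a, f'' a (b - a)⟫_ℝ) ≤ K * ‖b - a‖ ^ 3 := by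
  obtain ⟨d, rfl⟩ : ∃ d, b = a + d := ⟨b - a, by abel⟩
  rw [add_sub_cancel_left]
  have hmem : ∀ t ∈ Icc (0 : ℝ) 1, a + t • d ∈ D := fun t ht ↦ hD.add_smul_mem ha hb ht
  have hder : ∀ t ∈ Icc (0 : ℝ) 1, HasDerivWithinAt
      (fun t : ℝ ↦ f (a + t • d) - t * ⟪f' a, d⟫_ℝ - 1 / 2 * t ^ 2 * ⟪d, f'' a d⟫_ℝ)
      (⟪f' (a + t • d) - f' a - f'' a (t • d), d⟫_ℝ) (Icc 0 1) t := by
    intro t ht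
    have h1 : HasDerivAt (fun t : ℝ ↦ a + t • d) d t := by
      simpa using ((hasDerivAt_id t).smul_const d).const_add a
    have h2 : HasDerivAt (fun t : ℝ ↦ f (a + t • d)) (⟪f' (a + t • d), d⟫_ℝ) t := by
      simpa [Function.comp_def] using
        (hf _ (hmem t ht)).hasFDerivAt.comp_hasDerivAt t h1
    have h3 : HasDerivAt (fun t : ℝ ↦ t * ⟪f' a, d⟫_ℝ) (1 * ⟪f' a, d⟫_ℝ) t :=
      (hasDerivAt_id t).mul_const _
    have h4 : HasDerivAt (fun t : ℝ ↦ 1 / 2 * t ^ 2 * ⟪d, f'' a d⟫_ℝ)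
        (1 / 2 * (2 * t) * ⟪d, f'' a d⟫_ℝ) t := by
      simpa using (((hasDerivAt_pow 2 t).const_mul (1 / 2 : ℝ)).mul_const ⟪d, f'' a d⟫_ℝ)
    refine (((h2.sub h3).sub h4).congr_deriv ?_).hasDerivWithinAt
    rw [inner_sub_left, inner_sub_left, map_smul, real_inner_smul_left,
      real_inner_comm d (f'' a d)]
    ring
  have h := (convex_Icc (0 : ℝ) 1).norm_image_sub_le_of_norm_hasDerivWithin_le
    (C := K * ‖d‖ ^ 3) (x := 0) (y := 1) hder ?_ (by simp) (by simp)
  · have h' := (le_abs_self _).trans h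
    simp only [one_smul, zero_smul, add_zero, sub_zero, norm_one] at h'
    linarith
  · intro t ht
    have h5 := norm_sub_sub_fderiv_le hD hf' hK hLip ha (hmem t ht)
    rw [add_sub_cancel_left] at h5
    have h6 : ‖t • d‖ ≤ ‖d‖ := by
      rw [norm_smul, Real.norm_of_nonneg ht.1]
      exact mul_le_of_le_one_left (norm_nonneg _) ht.2
    calc _ ≤ _ := norm_inner_le_norm _ _
      _ ≤ K * ‖d‖ ^ 2 * ‖d‖ := by
        gcongr
        exact h5.trans (by gcongr)
      _ = _ := by ring

/-- The proximal point of a proper function lies in its effective domain. -/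
theorem prox_ne_top {X : Type*} [NormedAddCommGroup X]
    {g : X → EReal} {proxg : X → X} (hgproper : ∃ z : X, g z ≠ ⊤)
    (hproxg : ∀ w z : X,
        ((1/2 * ‖proxg w - w‖ ^ 2 : ℝ) : EReal) + g (proxg w) ≤
          ((1/2 * ‖z - w‖ ^ 2 : ℝ) : EReal) + g z) (w : X) : g (proxg w) ≠ ⊤ := by
  obtain ⟨z, hz⟩ := hgproper
  intro h
  have := hproxg w z
  rw [h, EReal.coe_add_top, top_le_iff] at this
  exact EReal.add_ne_top (EReal.coe_ne_top _) hz this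

/-- Optimality condition of the proximal subproblem: `w - prox_g w` is a subgradient of `g` at
`prox_g w`. -/
theorem sub_prox_mem_ESubdiff {X : Type*} [NormedAddCommGroup X] [InnerProductSpace ℝ X] 
    {g : X → EReal} {proxg : X → X} (hgproper : ∃ z : X, g z ≠ ⊤)
    (hgnebot : ∀ z : X, g z ≠ ⊥)
    (hgconv : ∀ u w : X, ∀ t : ℝ, t ∈ Set.Ioo (0:ℝ) 1 →
        g (t • u + (1 - t) • w) ≤ (t : EReal) * g u + ((1 - t : ℝ) : EReal) * g w)
    (hproxg : ∀ w z : X,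
        ((1/2 * ‖proxg w - w‖ ^ 2 : ℝ) : EReal) + g (proxg w) ≤
          ((1/2 * ‖z - w‖ ^ 2 : ℝ) : EReal) + g z) (w : X) :
    w - proxg w ∈ ESubdiff g (proxg w) := by
  intro z
  have hp := prox_ne_top hgproper hproxg w
  set p := proxg w with hpdef
  by_cases hz : g z = ⊤
  · rw [hz]; exact le_top
  obtain ⟨γ, hγ⟩ : ∃ r : ℝ, g p = r := ⟨_, (EReal.coe_toReal hp (hgnebot p)).symm⟩
  obtain ⟨ζ, hζ⟩ : ∃ r : ℝ, g z = r := ⟨_, (EReal.coe_toReal hz (hgnebot z)).symm⟩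
  rw [hγ, hζ, ← EReal.coe_add, EReal.coe_le_coe_iff]
  have key : ∀ t ∈ Ioo (0 : ℝ) 1,
      γ + ⟪w - p, z - p⟫_ℝ - ζ ≤ t * (1 / 2 * ‖z - p‖ ^ 2) := by
    intro t ht
    have h1 := (hproxg w (t • z + (1 - t) • p)).trans
      (add_le_add le_rfl (hgconv z p t ht))
    rw [← hpdef, hγ, hζ, ← EReal.coe_mul, ← EReal.coe_mul, ← EReal.coe_add, ← EReal.coe_add,
      ← EReal.coe_add, EReal.coe_le_coe_iff] at h1
    have h2 : t • z + (1 - t) • p - w = t • (z - p) - (w - p) := by module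
    rw [h2, norm_sub_sq_real (t • (z - p)), norm_smul, real_inner_smul_left, mul_pow, norm_sub_rev p w,
      real_inner_comm (w - p), Real.norm_eq_abs, sq_abs] at h1
    have h3 : t * (γ + ⟪w - p, z - p⟫_ℝ - ζ) ≤ t * (t * (1 / 2 * ‖z - p‖ ^ 2)) := by
      nlinarith
    exact le_of_mul_le_mul_left h3 ht.1
  have hlim : Tendsto (fun t : ℝ ↦ t * (1 / 2 * ‖z - p‖ ^ 2)) (𝓝[>] 0) (𝓝 0) := by
    have : Continuous (fun t : ℝ ↦ t * (1 / 2 * ‖z - p‖ ^ 2)) := by fun_prop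
    simpa using (this.tendsto 0).mono_left nhdsWithin_le_nhds
  have := ge_of_tendsto hlim
    (eventually_of_mem (Ioo_mem_nhdsGT (zero_lt_one' ℝ)) key)
  linarith

/-- A rejected regularization parameter `l` with trial step of length `s` is bounded by a constant
depending only on the data: `hgrow` is the growth bound coming from the decrease of the regularized
model and `hrej` the failure of the descent test, available for short steps. -/
theorem rejected_parameter_le {l s q σ K C δ : ℝ} (hl : 0 < l) (hs : 0 ≤ s)
    (hq : q ∈ Icc (2 : ℝ) 3) (hσ : σ ∈ Ioo (0 : ℝ) 1) (hK : 0 ≤ K) (hC : 0 ≤ C) (hδ : 0 < δ)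
    (hgrow : l / q * s ^ q ≤ C * (1 + s + s ^ 2))
    (hrej : s < δ → (1 - σ) * (l / q * s ^ q) < K * s ^ 3) :
    l ≤ 9 * C + 9 * C / δ ^ 3 + 3 * K / (1 - σ) := by
  obtain ⟨hq2, hq3⟩ := hq
  have hσ' : 0 < 1 - σ := by linarith [hσ.2]
  have hlq : l / 3 ≤ l / q := div_le_div_of_nonneg_left hl.le (by linarith) hq3
  have hA : 0 ≤ 9 * C / δ ^ 3 := by positivity
  have hB : 0 ≤ 3 * K / (1 - σ) := by positivity
  rcases le_total 1 s with h1 | h1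
  · have hsq : s ^ 2 ≤ s ^ q := by
      rw [← Real.rpow_natCast s 2]
      exact Real.rpow_le_rpow_of_exponent_le h1 (by simpa using hq2)
    have h2 : l / 3 * s ^ 2 ≤ 3 * C * s ^ 2 :=
      calc l / 3 * s ^ 2 ≤ l / q * s ^ q := by gcongr
        _ ≤ C * (1 + s + s ^ 2) := hgrow
        _ ≤ C * (3 * s ^ 2) := by gcongr; nlinarith
        _ = _ := by ring
    have := le_of_mul_le_mul_right h2 (by positivity)
    linarith
  rcases hs.eq_or_lt with rfl | hs0
  · have := hrej hδ
    rw [Real.zero_rpow (by linarith)] at this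
    simp at this
  have hs3 : s ^ 3 ≤ s ^ q := by
    rw [← Real.rpow_natCast s 3]
    exact Real.rpow_le_rpow_of_exponent_ge hs0 h1 (by simpa using hq3)
  have hlow : l / 3 * s ^ 3 ≤ l / q * s ^ q := by gcongr
  rcases lt_or_ge s δ with h2 | h2
  · have h3 : (1 - σ) * (l / 3) * s ^ 3 ≤ K * s ^ 3 := by
      have := mul_le_mul_of_nonneg_left hlow hσ'.le
      linarith [hrej h2]
    have h4 := le_of_mul_le_mul_right h3 (by positivity)
    have : l ≤ 3 * K / (1 - σ) := by rw [le_div_iff₀ hσ']; linarith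
    linarith [mul_nonneg (by norm_num : (0:ℝ) ≤ 9) hC]
  · have h3 : l / 3 * δ ^ 3 ≤ 3 * C :=
      calc l / 3 * δ ^ 3 ≤ l / 3 * s ^ 3 := by gcongr
        _ ≤ C * (1 + s + s ^ 2) := hlow.trans hgrow
        _ ≤ C * 3 := by gcongr; nlinarith
        _ = _ := by ring
    have : l ≤ 9 * C / δ ^ 3 := by rw [le_div_iff₀ (by positivity)]; linarith
    linarith [mul_nonneg (by norm_num : (0:ℝ) ≤ 9) hC]

/-- The effective domain of an extended-real-valued convex function is convex. -/
theorem convex_effective_domain {X : Type*} [AddCommGroup X] [Module ℝ X] {g : X → EReal}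
    (hgnebot : ∀ z : X, g z ≠ ⊥)
    (hgconv : ∀ u w : X, ∀ t : ℝ, t ∈ Set.Ioo (0:ℝ) 1 →
        g (t • u + (1 - t) • w) ≤ (t : EReal) * g u + ((1 - t : ℝ) : EReal) * g w) :
    Convex ℝ {z : X | g z ≠ ⊤} := by
  rw [convex_iff_forall_pos]
  intro u hu w hw a b ha hb hab htop
  obtain rfl : b = 1 - a := by linarith
  have h := hgconv u w a ⟨ha, by linarith⟩
  rw [htop, ← EReal.coe_toReal hu (hgnebot u), ← EReal.coe_toReal hw (hgnebot w),
    ← EReal.coe_mul, ← EReal.coe_mul, ← EReal.coe_add, top_le_iff] at h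
  exact EReal.coe_ne_top _ h

/-- Lemma 4.1: under Assumption 2, eventually the potential function Φ(y,v) = F(y - v) admits
at each (y^k, v^k) a subgradient (ξ^k, -ξ^k) with √2 ‖ξ^k‖ ≤ a ‖y^k - x^k‖^(q-1). -/
theorem subgradient_bound_for_potential
    {X : Type*} [NormedAddCommGroup X] [InnerProductSpace ℝ X] [FiniteDimensional ℝ X]
    -- the data of problem (1): f twice continuously differentiable on an open set O ⊇ dom g,
    -- g proper lsc convex, F = f + g bounded below
    (f : X → ℝ) (g : X → EReal) (f' : X → X) (f'' : X → X →L[ℝ] X)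
    (O : Set X) (hO : IsOpen O) (hOdom : {z : X | g z ≠ ⊤} ⊆ O)
    (hgproper : ∃ z : X, g z ≠ ⊤) (hgnebot : ∀ z : X, g z ≠ ⊥)
    (hglsc : LowerSemicontinuous g)
    (hgconv : ∀ u w : X, ∀ t : ℝ, t ∈ Set.Ioo (0:ℝ) 1 →
        g (t • u + (1 - t) • w) ≤ (t : EReal) * g u + ((1 - t : ℝ) : EReal) * g w)
    (hf1 : ∀ z ∈ O, HasGradientAt f (f' z) z)
    (hf2 : ∀ z ∈ O, HasFDerivAt f' (f'' z) z)
    (hf2c : ContinuousOn f'' O)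
    -- the proximal mapping of g
    (proxg : X → X)
    (hproxg : ∀ w z : X,
        ((1/2 * ‖proxg w - w‖ ^ 2 : ℝ) : EReal) + g (proxg w) ≤
          ((1/2 * ‖z - w‖ ^ 2 : ℝ) : EReal) + g z)
    (F : X → EReal) (hF : ∀ z : X, F z = (f z : EReal) + g z)
    (hFbdd : ∃ m : ℝ, ∀ z : X, (m : EReal) ≤ F z)
    -- Algorithm 1 parameters
    (q Lmin Lmax ϱ σ τ : ℝ)
    (hq : q ∈ Set.Icc (2:ℝ) 3) (hLmin : 0 < Lmin) (hLmm : Lmin < Lmax)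
    (hϱ : ϱ ∈ Set.Ioo (0:ℝ) 1) (hσ : σ ∈ Set.Ioo (0:ℝ) 1) (hτ : 1 < τ)
    -- the sequences generated by Algorithm 1
    (x y v : ℕ → X) (L L0 : ℕ → ℝ) (j : ℕ → ℕ)
    (hx0 : g (x 0) ≠ ⊤)
    (hL0 : ∀ k : ℕ, L0 k ∈ Set.Icc Lmin Lmax)
    (hLdef : ∀ k : ℕ, L k = τ ^ j k * L0 k)
    -- the quadratic model ϑ_k, the regularized model objective Θ_{k,L} and its KKT residual map
    (ϑ : ℕ → X → ℝ)
    (hϑ : ∀ k : ℕ, ∀ z : X, ϑ k z = f (x k) + ⟪f' (x k), z - x k⟫_ℝ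
        + 1/2 * ⟪z - x k, f'' (x k) (z - x k)⟫_ℝ)
    (Θ : ℕ → ℝ → X → EReal)
    (hΘ : ∀ k : ℕ, ∀ l : ℝ, ∀ z : X,
        Θ k l z = ((ϑ k z + l / q * ‖z - x k‖ ^ q : ℝ) : EReal) + g z)
    (Rk : ℕ → ℝ → X → X)
    (hRk : ∀ k : ℕ, ∀ l : ℝ, ∀ z : X, Rk k l z = z - proxg (z -
        (f' (x k) + f'' (x k) (z - x k) + (l * ‖z - x k‖ ^ (q - 2)) • (z - x k))))
    -- inexactness criterion and descent condition at each iteration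
    (hydom : ∀ k : ℕ, g (y k) ≠ ⊤)
    (hinex1 : ∀ k : ℕ, ‖Rk k (L k) (y k)‖ ≤ ϱ * L k * ‖y k - x k‖ ^ (q - 1))
    (hinex2 : ∀ k : ℕ, Θ k (L k) (y k) < Θ k (L k) (x k))
    (hdesc : ∀ k : ℕ, F (y k) ≤ F (x k) - ((σ * L k / q * ‖y k - x k‖ ^ q : ℝ) : EReal))
    (hv : ∀ k : ℕ, v k = Rk k (L k) (y k))
    (hxsucc : ∀ k : ℕ, x (k + 1) = if F (y k) < F (y k - v k) then y k else y k - v k)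
    -- if j_k ≥ 1, the previous trial point failed the descent test
    (hback : ∀ k : ℕ, 1 ≤ j k → ∃ yt : X, g yt ≠ ⊤ ∧
        ‖Rk k (L k / τ) yt‖ ≤ ϱ * (L k / τ) * ‖yt - x k‖ ^ (q - 1) ∧
        Θ k (L k / τ) yt < Θ k (L k / τ) (x k) ∧
        F (x k) - ((σ * (L k / τ) / q * ‖yt - x k‖ ^ q : ℝ) : EReal) < F yt)
    -- Assumption 2: bounded level set; ∇²f locally Lipschitz on an open convex set N ⊇ ω(x⁰)
    (hlevel : Bornology.IsBounded {z : X | F z ≤ F (x 0)})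
    (N : Set X) (hNopen : IsOpen N) (hNconv : Convex ℝ N)
    (hNomega : {z : X | MapClusterPt z atTop x} ⊆ N)
    (hHloc : ∀ z ∈ N, ∃ K : ℝ, 0 < K ∧ ∃ δ : ℝ, 0 < δ ∧
        ∀ a ∈ Metric.ball z δ ∩ N, ∀ b ∈ Metric.ball z δ ∩ N,
          ‖f'' a - f'' b‖ ≤ K * ‖a - b‖) :
    ∃ a : ℝ, 0 < a ∧ ∃ k0 : ℕ, ∀ k : ℕ, k0 ≤ k →
      ∃ w ∈ ESubdiff g (y k - v k),
        Real.sqrt 2 * ‖f' (y k - v k) + w‖ ≤ a * ‖y k - x k‖ ^ (q - 1) := by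
  have hpdom := prox_ne_top hgproper hproxg
  have hsub := sub_prox_mem_ESubdiff hgproper hgnebot hgconv hproxg
  obtain ⟨hq2, hq3⟩ := hq
  have hq0 : 0 < q := by linarith
  obtain ⟨hϱ0, hϱ1⟩ := hϱ
  have hσ' := hσ
  obtain ⟨hσ0, hσ1⟩ := hσ'
  obtain ⟨G, hG⟩ : ∃ G : X → ℝ, ∀ z, g z ≠ ⊤ → g z = (G z : EReal) :=
    ⟨fun z ↦ (g z).toReal, fun z hz ↦ (EReal.coe_toReal hz (hgnebot z)).symm⟩
  have hFG : ∀ z, g z ≠ ⊤ → F z = ((f z + G z : ℝ) : EReal) := by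
    intro z hz
    rw [hF, hG z hz, EReal.coe_add]
  have hpeq : ∀ k, y k - v k = proxg (y k - (f' (x k) + f'' (x k) (y k - x k) +
      (L k * ‖y k - x k‖ ^ (q - 2)) • (y k - x k))) := by
    intro k
    rw [hv, hRk, sub_sub_cancel]
  have hpkdom : ∀ k, g (y k - v k) ≠ ⊤ := fun k ↦ hpeq k ▸ hpdom _
  have hxdom : ∀ k, g (x k) ≠ ⊤ := by
    intro k
    cases k with
    | zero => exact hx0
    | succ k =>
      rw [hxsucc]
      split_ifs
      exacts [hydom k, hpkdom k]
  have hτ0 : 0 < τ := by linarith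
  have hLlow : ∀ k, Lmin ≤ L k := by
    intro k
    rw [hLdef]
    calc Lmin ≤ 1 * L0 k := by rw [one_mul]; exact (hL0 k).1
      _ ≤ τ ^ j k * L0 k := by
        gcongr
        · exact hLmin.le.trans (hL0 k).1
        · exact one_le_pow₀ hτ.le
  have hLpos : ∀ k, 0 < L k := fun k ↦ hLmin.trans_le (hLlow k)
  -- the objective values decrease, hence the steps tend to zero
  obtain ⟨φ, hφ⟩ : ∃ φ : ℕ → ℝ, ∀ k, φ k = f (x k) + G (x k) := ⟨_, fun _ ↦ rfl⟩
  have hFφ : ∀ k, F (x k) = (φ k : EReal) := fun k ↦ by rw [hFG _ (hxdom k), hφ]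
  have hstep : ∀ k, φ (k + 1) ≤ φ k - σ * L k / q * ‖y k - x k‖ ^ q := by
    intro k
    have h1 : F (x (k + 1)) ≤ F (y k) := by
      rw [hxsucc]
      split_ifs with h
      exacts [le_rfl, not_lt.1 h]
    have h2 := h1.trans (hdesc k)
    rwa [hFφ, hFφ, ← EReal.coe_sub, EReal.coe_le_coe_iff] at h2
  have hanti : Antitone φ := antitone_nat_of_succ_le fun k ↦ (hstep k).trans <|
    sub_le_self _ (by have := hLpos k; positivity)
  have hxlevel : ∀ k, x k ∈ {z : X | F z ≤ F (x 0)} := by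
    intro k
    change F (x k) ≤ F (x 0)
    rw [hFφ, hFφ, EReal.coe_le_coe_iff]
    exact hanti k.zero_le
  have hbdd : BddBelow (range φ) := by
    obtain ⟨m, hm⟩ := hFbdd
    refine ⟨m, ?_⟩
    rintro _ ⟨k, rfl⟩
    have := hm (x k)
    rwa [hFφ, EReal.coe_le_coe_iff] at this
  have hd0 : Tendsto (fun k ↦ ‖y k - x k‖) atTop (𝓝 0) := by
    have hφlim := tendsto_atTop_ciInf hanti hbdd
    have hdiff : Tendsto (fun k ↦ φ k - φ (k + 1)) atTop (𝓝 0) := by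
      simpa using hφlim.sub (hφlim.comp (tendsto_add_atTop_nat 1))
    rw [Metric.tendsto_atTop']
    intro ε hε
    have hpos : 0 < σ * Lmin / q * ε ^ q := by positivity
    obtain ⟨n, hn⟩ := eventually_atTop.1 (hdiff.eventually (gt_mem_nhds hpos))
    refine ⟨n, fun k hk ↦ ?_⟩
    rw [Real.dist_eq, sub_zero, abs_norm]
    by_contra! hcon
    have h1 := hn k hk.le
    have h2 := hstep k
    have h3 : σ * Lmin / q * ε ^ q ≤ σ * L k / q * ‖y k - x k‖ ^ q := by
      have := hLlow k
      have := hLpos k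
      gcongr
    linarith
  -- a failing subsequence along which the iterates converge to a cluster point
  by_contra! hcon
  have hfail : ∀ n : ℕ, ∃ k, n ≤ k ∧ ∀ w ∈ ESubdiff g (y k - v k),
      ((n : ℝ) + 1) * ‖y k - x k‖ ^ (q - 1) < √2 * ‖f' (y k - v k) + w‖ :=
    fun n ↦ hcon (n + 1) (by positivity) n
  choose κ hκn hκ using hfail
  have hκtop : Tendsto κ atTop atTop := tendsto_atTop_mono hκn tendsto_id
  obtain ⟨z, -, ψ, hψ, hz⟩ := tendsto_subseq_of_bounded hlevel fun n ↦ hxlevel (κ n)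
  have hμtop : Tendsto (fun n ↦ κ (ψ n)) atTop atTop := hκtop.comp hψ.tendsto_atTop
  have hzN : z ∈ N := hNomega (MapClusterPt.of_comp hμtop hz.mapClusterPt)
  -- regularity of `f` on the part of the domain of `g` close to the cluster point
  obtain ⟨K, hK, δ₁, hδ₁, hLip⟩ := hHloc z hzN
  obtain ⟨δ₂, hδ₂, hδN⟩ := Metric.isOpen_iff.1 hNopen z hzN
  obtain ⟨δ, hδ, hδ1, hδ2⟩ : ∃ δ : ℝ, 0 < δ ∧ δ ≤ δ₁ ∧ δ ≤ δ₂ :=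
    ⟨min δ₁ δ₂, lt_min hδ₁ hδ₂, min_le_left _ _, min_le_right _ _⟩
  obtain ⟨D, hD⟩ : ∃ D : Set X, D = {u : X | g u ≠ ⊤} ∩ ball z δ := ⟨_, rfl⟩
  have hDconv : Convex ℝ D :=
    hD ▸ (convex_effective_domain hgnebot hgconv).inter (convex_ball z δ)
  have hDmem : ∀ u, g u ≠ ⊤ → ‖u - z‖ < δ → u ∈ D := fun u h1 h2 ↦ by
    rw [hD]; exact ⟨h1, by rwa [mem_ball, dist_eq_norm]⟩
  have hDnorm : ∀ u ∈ D, ‖u - z‖ < δ := fun u hu ↦ by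
    rw [hD] at hu; simpa [dist_eq_norm] using hu.2
  have hDO : ∀ u ∈ D, u ∈ O := fun u hu ↦ hOdom (by rw [hD] at hu; exact hu.1)
  have hballN : ∀ u, ‖u - z‖ < δ → u ∈ ball z δ₁ ∩ N := fun u hu ↦ by
    rw [← dist_eq_norm] at hu
    exact ⟨hu.trans_le hδ1, hδN (hu.trans_le hδ2)⟩
  have hLipD : ∀ a ∈ D, ∀ b ∈ D, ‖f'' a - f'' b‖ ≤ K * ‖a - b‖ := fun a ha b hb ↦
    hLip a (hballN a (hDnorm a ha)) b (hballN b (hDnorm b hb))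
  have hfD : ∀ u ∈ D, HasGradientAt f (f' u) u := fun u hu ↦ hf1 u (hDO u hu)
  have hf'D : ∀ u ∈ D, HasFDerivAt f' (f'' u) u := fun u hu ↦ hf2 u (hDO u hu)
  obtain ⟨M, hM0, hM⟩ : ∃ M : ℝ, 0 ≤ M ∧ ∀ u ∈ D, ‖f'' u‖ ≤ M := by
    refine ⟨‖f'' z‖ + K * δ, by positivity, fun u hu ↦ ?_⟩
    have h1 := hLip u (hballN u (hDnorm u hu)) z (hballN z (by simpa using hδ))
    have h2 : K * ‖u - z‖ ≤ K * δ := by gcongr; exact (hDnorm u hu).le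
    linarith [norm_le_norm_add_norm_sub (f'' z) (f'' u), norm_sub_rev (f'' z) (f'' u)]
  have hf'Lip : ∀ a ∈ D, ∀ b ∈ D, ‖f' b - f' a‖ ≤ M * ‖b - a‖ := fun a ha b hb ↦
    hDconv.norm_image_sub_le_of_norm_hasFDerivWithin_le
      (fun u hu ↦ (hf'D u hu).hasFDerivWithinAt) hM ha hb
  have hnear : ∀ᶠ n in atTop, ‖x (κ (ψ n)) - z‖ < δ / 2 := by
    have := hz.eventually (ball_mem_nhds z (half_pos hδ))
    simpa [dist_eq_norm] using this
  obtain ⟨b, hb⟩ : ∃ b, b ∈ D := by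
    obtain ⟨n, hn⟩ := hnear.exists
    exact ⟨_, hDmem _ (hxdom _) (by linarith)⟩
  have hDdiam : ∀ u ∈ D, ‖u - b‖ ≤ 2 * δ := fun u hu ↦ by
    have := norm_sub_le_norm_sub_add_norm_sub u z b
    rw [norm_sub_rev z b] at this
    linarith [hDnorm u hu, hDnorm b hb]
  obtain ⟨Γ, hΓ0, hΓ⟩ : ∃ Γ : ℝ, 0 ≤ Γ ∧ ∀ u ∈ D, ‖f' u‖ ≤ Γ := by
    refine ⟨‖f' b‖ + M * (2 * δ), by positivity, fun u hu ↦ ?_⟩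
    have h1 := hf'Lip b hb u hu
    have h2 : M * ‖u - b‖ ≤ M * (2 * δ) := by gcongr; exact hDdiam u hu
    linarith [norm_le_norm_add_norm_sub (f' b) (f' u), norm_sub_rev (f' b) (f' u)]
  obtain ⟨B, hB⟩ : ∃ B : ℝ, ∀ k, x k ∈ D → G (x k) ≤ B := by
    refine ⟨φ 0 - f b + Γ * (2 * δ), fun k hk ↦ ?_⟩
    have h1 := hDconv.norm_image_sub_le_of_norm_hasFDerivWithin_le
      (fun u hu ↦ (hfD u hu).hasFDerivAt.hasFDerivWithinAt)
      (fun u hu ↦ (LinearIsometryEquiv.norm_map _ _).trans_le (hΓ u hu)) hb hk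
    have h2 : Γ * ‖x k - b‖ ≤ Γ * (2 * δ) := by gcongr; exact hDdiam _ hk
    have h3 := hanti k.zero_le
    rw [hφ k] at h3
    linarith [neg_abs_le (f (x k) - f b), Real.norm_eq_abs (f (x k) - f b)]
  -- an affine minorant of `g`
  obtain ⟨A, c, hc0, hAc⟩ : ∃ A c : ℝ, 0 ≤ c ∧ ∀ u, g u ≠ ⊤ → ∀ a ∈ D,
      A - c * ‖u - a‖ ≤ G u := by
    obtain ⟨p, hp⟩ : ∃ p, p = proxg 0 := ⟨_, rfl⟩
    refine ⟨G p + ⟪0 - p, z - p⟫_ℝ - ‖(0 : X) - p‖ * δ, ‖(0 : X) - p‖, norm_nonneg _,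
      fun u hu a ha ↦ ?_⟩
    have h1 := hsub 0 u
    rw [← hp, hG p (hp ▸ hpdom 0), hG u hu, ← EReal.coe_add, EReal.coe_le_coe_iff] at h1
    have h2 : u - p = (u - a) + (a - z) + (z - p) := by abel
    rw [h2, inner_add_right, inner_add_right] at h1
    have h3 := neg_le_of_abs_le (abs_real_inner_le_norm (0 - p) (u - a))
    have h4 := neg_le_of_abs_le (abs_real_inner_le_norm (0 - p) (a - z))
    have h5 : ‖(0 : X) - p‖ * ‖a - z‖ ≤ ‖(0 : X) - p‖ * δ := by
      gcongr; exact (hDnorm a ha).le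
    linarith
  -- the regularization parameters stay bounded near the cluster point
  obtain ⟨Λ, hΛ0, hΛ⟩ : ∃ Λ : ℝ, 0 ≤ Λ ∧ ∀ k, ‖x k - z‖ < δ / 2 → L k ≤ Λ := by
    obtain ⟨C, hC⟩ : ∃ C : ℝ, C = |B - A| + Γ + c + M := ⟨_, rfl⟩
    have hC0 : 0 ≤ C := by rw [hC]; positivity
    obtain ⟨E, hE⟩ : ∃ E : ℝ, E = 9 * C + 9 * C / (δ / 2) ^ 3 + 3 * K / (1 - σ) := ⟨_, rfl⟩
    have hE0 : 0 ≤ E := by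
      have : 0 < 1 - σ := by linarith
      rw [hE]; positivity
    refine ⟨Lmax + τ * E, by have := hLmin.trans hLmm; positivity, fun k hk ↦ ?_⟩
    rcases Nat.eq_zero_or_pos (j k) with hj | hj
    · rw [hLdef, hj, pow_zero, one_mul]
      linarith [(hL0 k).2, mul_nonneg hτ0.le hE0]
    obtain ⟨yt, hyt, -, hmodel, hdec⟩ := hback k hj
    have hl : 0 < L k / τ := div_pos (hLpos k) hτ0
    obtain ⟨l, hle⟩ : ∃ l, l = L k / τ := ⟨_, rfl⟩
    rw [← hle] at hmodel hdec hl
    have hxD : x k ∈ D := hDmem _ (hxdom k) (by linarith)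
    rw [hΘ, hΘ, hϑ, hϑ, hG _ hyt, hG _ (hxdom k), ← EReal.coe_add, ← EReal.coe_add,
      EReal.coe_lt_coe_iff, sub_self, norm_zero, Real.zero_rpow hq0.ne', map_zero,
      inner_zero_right, inner_zero_right] at hmodel
    rw [hFφ, hFG _ hyt, ← EReal.coe_sub, EReal.coe_lt_coe_iff, hφ] at hdec
    have hlin := neg_le_of_abs_le (abs_real_inner_le_norm (f' (x k)) (yt - x k))
    have hquad := neg_le_of_abs_le
      (abs_real_inner_le_norm (yt - x k) (f'' (x k) (yt - x k)))
    have hs0 := norm_nonneg (yt - x k)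
    have hlin' : ‖f' (x k)‖ * ‖yt - x k‖ ≤ Γ * ‖yt - x k‖ := by gcongr; exact hΓ _ hxD
    have hquad' : ‖yt - x k‖ * ‖f'' (x k) (yt - x k)‖ ≤ M * ‖yt - x k‖ ^ 2 :=
      calc _ ≤ ‖yt - x k‖ * (M * ‖yt - x k‖) := by
            gcongr; exact (f'' (x k)).le_of_opNorm_le (hM _ hxD) _
        _ = _ := by ring
    have hlE : l ≤ E := by
      rw [hE]
      refine rejected_parameter_le (s := ‖yt - x k‖) hl hs0 ⟨hq2, hq3⟩ hσ hK.le hC0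
        (half_pos hδ) ?_ fun hs ↦ ?_
      · have h1 := hAc yt hyt (x k) hxD
        have h2 := hB k hxD
        have h3 := le_abs_self (B - A)
        have h4 : C * (1 + ‖yt - x k‖ + ‖yt - x k‖ ^ 2) ≥
            |B - A| + (Γ + c) * ‖yt - x k‖ + M * ‖yt - x k‖ ^ 2 := by
          have h5 : 0 ≤ |B - A| := abs_nonneg _
          rw [hC, ge_iff_le, ← sub_nonneg]
          ring_nf
          positivity
        have h6 : 0 ≤ M * ‖yt - x k‖ ^ 2 := by positivity
        linarith
      · have hytD : yt ∈ D := hDmem _ hyt (by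
          linarith [norm_sub_le_norm_sub_add_norm_sub yt (x k) z])
        have h1 := sub_quadratic_model_le hDconv hfD hf'D hK.le hLipD hxD hytD
        have h2 : σ * l / q * ‖yt - x k‖ ^ q = σ * (l / q * ‖yt - x k‖ ^ q) := by ring
        rw [h2] at hdec
        linarith
    have : L k = τ * l := by rw [hle]; field_simp
    rw [this]
    have := mul_le_mul_of_nonneg_left hlE hτ0.le
    linarith
  -- the subgradient estimate near the cluster point
  obtain ⟨C, hC⟩ : ∃ C : ℝ, C = √2 * (M * Λ + K + 2 * Λ) := ⟨_, rfl⟩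
  have hdμ : Tendsto (fun n ↦ ‖y (κ (ψ n)) - x (κ (ψ n))‖) atTop (𝓝 0) := hd0.comp hμtop
  have hdΛ : Tendsto (fun n ↦ Λ * ‖y (κ (ψ n)) - x (κ (ψ n))‖) atTop (𝓝 0) := by
    simpa using hdμ.const_mul Λ
  have hlarge : ∀ᶠ n in atTop, C ≤ (ψ n : ℝ) :=
    (tendsto_natCast_atTop_atTop.comp hψ.tendsto_atTop).eventually_ge_atTop C
  have hδ4 : 0 < δ / 4 := by positivity
  obtain ⟨n, hxz, hd1, hdδ, hvδ, hCn⟩ := (hnear.and <| (hdμ.eventually (gt_mem_nhds one_pos)).and <|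
    (hdμ.eventually (gt_mem_nhds hδ4)).and <| (hdΛ.eventually (gt_mem_nhds hδ4)).and
      hlarge).exists
  have hκ' := hκ (ψ n)
  generalize κ (ψ n) = k at hxz hd1 hdδ hvδ hκ'
  have hw := hsub (y k - (f' (x k) + f'' (x k) (y k - x k) +
      (L k * ‖y k - x k‖ ^ (q - 2)) • (y k - x k)))
  rw [← hpeq] at hw
  have hlt := hκ' _ hw
  have hdn := norm_nonneg (y k - x k)
  have hvn : ‖v k‖ ≤ Λ * ‖y k - x k‖ ^ (q - 1) := by
    rw [hv]
    refine (hinex1 k).trans ?_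
    have h1 := hΛ k hxz
    have h2 := hLpos k
    gcongr
    nlinarith
  have hpow1 : ‖y k - x k‖ ^ (q - 1) ≤ ‖y k - x k‖ := by
    have := Real.rpow_le_rpow_of_exponent_ge' hdn hd1.le zero_le_one (by linarith : 1 ≤ q - 1)
    rwa [Real.rpow_one] at this
  have hpow2 : ‖y k - x k‖ ^ 2 ≤ ‖y k - x k‖ ^ (q - 1) := by
    rw [← Real.rpow_natCast _ 2]
    exact Real.rpow_le_rpow_of_exponent_ge' hdn hd1.le (by linarith) (by norm_num; linarith)
  have hxD : x k ∈ D := hDmem _ (hxdom k) (by linarith)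
  have hyz : ‖y k - z‖ < 3 * δ / 4 := by
    linarith [norm_sub_le_norm_sub_add_norm_sub (y k) (x k) z]
  have hyD : y k ∈ D := hDmem _ (hydom k) (by linarith)
  have hpD : y k - v k ∈ D := by
    refine hDmem _ (hpkdom k) ?_
    have h1 : y k - v k - z = (y k - z) - v k := by abel
    have h2 := mul_le_mul_of_nonneg_left hpow1 hΛ0
    rw [h1]
    linarith [norm_sub_le (y k - z) (v k)]
  have hgrad : ‖f' (y k - v k) - f' (y k)‖ ≤ M * ‖v k‖ := by
    simpa using hf'Lip _ hyD _ hpD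
  have htaylor := norm_sub_sub_fderiv_le hDconv hf'D hK.le hLipD hxD hyD
  have hreg : ‖(L k * ‖y k - x k‖ ^ (q - 2)) • (y k - x k)‖ ≤ Λ * ‖y k - x k‖ ^ (q - 1) := by
    have h1 : ‖y k - x k‖ ^ (q - 1) = ‖y k - x k‖ ^ (q - 2) * ‖y k - x k‖ := by
      rw [← Real.rpow_add_one' hdn (by linarith)]
      congr 1; ring
    rw [norm_smul, Real.norm_of_nonneg (by have := hLpos k; positivity), h1, mul_assoc]
    gcongr
    exact hΛ k hxz
  have hsplit : f' (y k - v k) + (y k - (f' (x k) + f'' (x k) (y k - x k) +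
        (L k * ‖y k - x k‖ ^ (q - 2)) • (y k - x k)) - (y k - v k)) =
      (f' (y k - v k) - f' (y k)) + (f' (y k) - f' (x k) - f'' (x k) (y k - x k)) -
        (L k * ‖y k - x k‖ ^ (q - 2)) • (y k - x k) + v k := by abel
  rw [hsplit] at hlt
  have hbound := ((norm_add_le _ _).trans (add_le_add_left
    ((norm_sub_le _ _).trans (add_le_add_left (norm_add_le _ _) _)) _)).trans
    (add_le_add (add_le_add (add_le_add hgrad htaylor) hreg) hvn)
  have hMv := mul_le_mul_of_nonneg_left hvn hM0
  have hKd := mul_le_mul_of_nonneg_left hpow2 hK.le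
  have hfinal := hlt.trans_le (mul_le_mul_of_nonneg_left (hbound.trans
    (b := _) (c := (M * Λ + K + 2 * Λ) * ‖y k - x k‖ ^ (q - 1)) (by linarith))
    (Real.sqrt_nonneg 2))
  rw [← mul_assoc, ← hC] at hfinal
  have hr := Real.rpow_nonneg hdn (q - 1)
  have := mul_le_mul_of_nonneg_right hCn hr
  linarith
end

section
/- Let {x^k} be generated by Algorithm 1. Suppose Assumption 2 holds and that F is a KL function. Then ∑_{k=0}^∞ ‖x^{k+1} − x^k‖ < ∞, and consequently {x^k} converges to a point x̄ ∈ 𝒮*. -/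
open Filter Metric Real Set
open scoped InnerProductSpace Topology Pointwise

/-- Along a convergent sequence, a limit of upper bounds is an upper bound at the limit. -/
theorem LowerSemicontinuous.le_coe_of_tendsto {X : Type*} [TopologicalSpace X] {g : X → EReal}
    (hlsc : LowerSemicontinuous g) {u : ℕ → X} {z : X} (hu : Tendsto u atTop (𝓝 z))
    {c : ℕ → ℝ} {c₀ : ℝ}
    (hc : Tendsto c atTop (𝓝 c₀)) (h : ∀ n, g (u n) ≤ (c n : EReal)) :
    g z ≤ (c₀ : EReal) := by
  by_contra! hlt
  obtain ⟨b, hb1, hb2⟩ := EReal.lt_iff_exists_real_btwn.1 hlt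
  have h1 : ∀ᶠ n in atTop, (b : EReal) < g (u n) := hu.eventually (hlsc z b hb2)
  have h2 : ∀ᶠ n in atTop, c n < b := hc.eventually (gt_mem_nhds (by exact_mod_cast hb1))
  obtain ⟨n, h3, h4⟩ := (h1.and h2).exists
  have h5 := h3.trans_le (h n)
  exact lt_asymm h4 (by exact_mod_cast h5)

section ExtendedConvex

variable {X : Type*} [NormedAddCommGroup X] [InnerProductSpace ℝ X]

theorem mem_eSubdiff_iff_toReal {g : X → EReal} (hbot : ∀ z, g z ≠ ⊥) {a : X} (ha : g a ≠ ⊤)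
    {w : X} : w ∈ ESubdiff g a ↔
      ∀ z, g z ≠ ⊤ → (g a).toReal + ⟪w, z - a⟫_ℝ ≤ (g z).toReal := by
  constructor
  · intro h z hz
    have h1 := h z
    rw [← EReal.coe_toReal ha (hbot a), ← EReal.coe_toReal hz (hbot z)] at h1
    exact_mod_cast h1
  · intro h z
    by_cases hz : g z = ⊤
    · simp [hz]
    · have h1 := h z hz
      rw [← EReal.coe_toReal ha (hbot a), ← EReal.coe_toReal hz (hbot z)]
      exact_mod_cast h1

theorem eReal_jensen_toReal {g : X → EReal} (hbot : ∀ z, g z ≠ ⊥)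
    (hconv : ∀ u w : X, ∀ t : ℝ, t ∈ Set.Ioo (0:ℝ) 1 →
        g (t • u + (1 - t) • w) ≤ (t : EReal) * g u + ((1 - t : ℝ) : EReal) * g w)
    {u w : X} (hu : g u ≠ ⊤) (hw : g w ≠ ⊤) {t : ℝ} (ht : t ∈ Set.Ioo (0:ℝ) 1) :
    g (t • u + (1 - t) • w) ≠ ⊤ ∧
      (g (t • u + (1 - t) • w)).toReal ≤ t * (g u).toReal + (1 - t) * (g w).toReal := by
  have h := hconv u w t ht
  rw [← EReal.coe_toReal hu (hbot u), ← EReal.coe_toReal hw (hbot w), ← EReal.coe_mul,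
    ← EReal.coe_mul, ← EReal.coe_add] at h
  have h1 : g (t • u + (1 - t) • w) ≠ ⊤ := ne_top_of_le_ne_top (EReal.coe_ne_top _) h
  refine ⟨h1, ?_⟩
  rw [← EReal.coe_toReal h1 (hbot _)] at h
  exact_mod_cast h

theorem convex_setOf_ne_top {g : X → EReal} (hbot : ∀ z, g z ≠ ⊥)
    (hconv : ∀ u w : X, ∀ t : ℝ, t ∈ Set.Ioo (0:ℝ) 1 →
        g (t • u + (1 - t) • w) ≤ (t : EReal) * g u + ((1 - t : ℝ) : EReal) * g w) :
    Convex ℝ {z | g z ≠ ⊤} := by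
  rw [convex_iff_forall_pos]
  intro u hu w hw a b ha hb hab
  obtain rfl : b = 1 - a := by linarith
  exact (eReal_jensen_toReal hbot hconv hu hw ⟨ha, by linarith⟩).1

/-- A point attaining the proximal minimum lies in the domain, and its displacement is a
subgradient there. -/
theorem sub_mem_eSubdiff_of_prox {g : X → EReal} (hbot : ∀ z, g z ≠ ⊥)
    (hproper : ∃ z, g z ≠ ⊤)
    (hconv : ∀ u w : X, ∀ t : ℝ, t ∈ Set.Ioo (0:ℝ) 1 →
        g (t • u + (1 - t) • w) ≤ (t : EReal) * g u + ((1 - t : ℝ) : EReal) * g w)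
    {w p : X} (hp : ∀ z, ((1/2 * ‖p - w‖ ^ 2 : ℝ) : EReal) + g p ≤
          ((1/2 * ‖z - w‖ ^ 2 : ℝ) : EReal) + g z) :
    g p ≠ ⊤ ∧ w - p ∈ ESubdiff g p := by
  have hpt : g p ≠ ⊤ := by
    obtain ⟨z, hz⟩ := hproper
    intro h
    have h1 := hp z
    rw [h, ← EReal.coe_toReal hz (hbot z), ← EReal.coe_add, EReal.coe_add_top] at h1
    exact EReal.coe_ne_top _ (top_le_iff.1 h1)
  refine ⟨hpt, (mem_eSubdiff_iff_toReal hbot hpt).2 fun z hz => ?_⟩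
  have hreal : ∀ z, g z ≠ ⊤ → 1/2 * ‖p - w‖ ^ 2 + (g p).toReal ≤
      1/2 * ‖z - w‖ ^ 2 + (g z).toReal := by
    intro z hz
    have h1 := hp z
    rw [← EReal.coe_toReal hpt (hbot p), ← EReal.coe_toReal hz (hbot z)] at h1
    exact_mod_cast h1
  have key : ∀ t ∈ Set.Ioo (0:ℝ) 1, (g p).toReal + ⟪w - p, z - p⟫_ℝ - (g z).toReal ≤
      t * (1/2 * ‖z - p‖ ^ 2) := by
    intro t ht
    obtain ⟨h1, h2⟩ := eReal_jensen_toReal hbot hconv hz hpt ht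
    have h3 := hreal _ h1
    have h4 : t • z + (1 - t) • p - w = (p - w) + t • (z - p) := by module
    have h5 : ⟪w - p, z - p⟫_ℝ = - ⟪p - w, z - p⟫_ℝ := by
      rw [← inner_neg_left, neg_sub]
    rw [h4, norm_add_sq_real, inner_smul_right, norm_smul, mul_pow, Real.norm_eq_abs,
      sq_abs] at h3
    have h6 : t * ((g p).toReal + ⟪w - p, z - p⟫_ℝ - (g z).toReal) ≤
        t * (t * (1/2 * ‖z - p‖ ^ 2)) := by rw [h5]; nlinarith
    exact le_of_mul_le_mul_left h6 ht.1
  have hlim : Tendsto (fun t : ℝ => t * (1/2 * ‖z - p‖ ^ 2)) (𝓝[>] 0) (𝓝 0) := by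
    have : Tendsto (fun t : ℝ => t * (1/2 * ‖z - p‖ ^ 2)) (𝓝 0)
        (𝓝 (0 * (1/2 * ‖z - p‖ ^ 2))) := tendsto_id.mul_const _
    rw [zero_mul] at this
    exact this.mono_left nhdsWithin_le_nhds
  have := ge_of_tendsto hlim
    (Filter.mem_of_superset (Ioo_mem_nhdsGT (zero_lt_one' ℝ)) key)
  linarith

/-- The graph of the subdifferential is closed, and values converge along it. -/
theorem eSubdiff_closed_graph {g : X → EReal} (hbot : ∀ z, g z ≠ ⊥) (hproper : ∃ z, g z ≠ ⊤)
    (hlsc : LowerSemicontinuous g) {u w : ℕ → X} {z p : X} (hu : ∀ n, g (u n) ≠ ⊤)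
    (hw : ∀ n, w n ∈ ESubdiff g (u n)) (huz : Tendsto u atTop (𝓝 z))
    (hwp : Tendsto w atTop (𝓝 p)) :
    g z ≠ ⊤ ∧ p ∈ ESubdiff g z ∧
      Tendsto (fun n => (g (u n)).toReal) atTop (𝓝 (g z).toReal) := by
  have hlim : ∀ a : X, Tendsto (fun n => (g a).toReal - ⟪w n, a - u n⟫_ℝ) atTop
      (𝓝 ((g a).toReal - ⟪p, a - z⟫_ℝ)) := fun a =>
    tendsto_const_nhds.sub (hwp.inner (tendsto_const_nhds.sub huz))
  have hle : ∀ a, g a ≠ ⊤ → ∀ n, (g (u n)).toReal ≤ (g a).toReal - ⟪w n, a - u n⟫_ℝ :=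
    fun a ha n => by
      linarith [(mem_eSubdiff_iff_toReal hbot (hu n)).1 (hw n) a ha]
  have hlez : ∀ a, g a ≠ ⊤ → g z ≤ (((g a).toReal - ⟪p, a - z⟫_ℝ : ℝ) : EReal) :=
    fun a ha => hlsc.le_coe_of_tendsto huz (hlim a) fun n => by
      rw [← EReal.coe_toReal (hu n) (hbot _)]
      exact_mod_cast hle a ha n
  have hz : g z ≠ ⊤ := by
    obtain ⟨a, ha⟩ := hproper
    exact ne_top_of_le_ne_top (EReal.coe_ne_top _) (hlez a ha)
  refine ⟨hz, (mem_eSubdiff_iff_toReal hbot hz).2 fun a ha => ?_, ?_⟩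
  · have h := hlez a ha
    rw [← EReal.coe_toReal hz (hbot z)] at h
    have h' : (g z).toReal ≤ (g a).toReal - ⟪p, a - z⟫_ℝ := by exact_mod_cast h
    linarith
  · have hz' := hlim z
    rw [sub_self, inner_zero_right, sub_zero] at hz'
    rw [tendsto_order]
    refine ⟨fun b hb => ?_, fun b hb => ?_⟩
    · have hb' : (b : EReal) < g z := by
        rw [← EReal.coe_toReal hz (hbot z)]
        exact_mod_cast hb
      filter_upwards [huz.eventually (hlsc z b hb')] with n hn
      rw [← EReal.coe_toReal (hu n) (hbot _)] at hn
      exact_mod_cast hn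
    · filter_upwards [hz'.eventually (gt_mem_nhds hb)] with n hn
      exact (hle z hz n).trans_lt hn

end ExtendedConvex

section Taylor

variable {X : Type*} [NormedAddCommGroup X] [InnerProductSpace ℝ X]

theorem norm_gradient_taylor_le {f' : X → X} {f'' : X → X →L[ℝ] X} {D : Set X}
    (hD : Convex ℝ D) (hf2 : ∀ z ∈ D, HasFDerivAt f' (f'' z) z) {a b : X} (ha : a ∈ D)
    (hb : b ∈ D) {C r : ℝ} (hC : 0 ≤ C)
    (hLip : ∀ z ∈ D, ‖z - a‖ < r → ‖f'' z - f'' a‖ ≤ C * ‖z - a‖) (hr : ‖b - a‖ < r) :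
    ‖f' b - f' a - f'' a (b - a)‖ ≤ C * ‖b - a‖ ^ 2 := by
  have hseg : segment ℝ a b ⊆ D := hD.segment_subset ha hb
  have hdist : ∀ z ∈ segment ℝ a b, ‖z - a‖ ≤ ‖b - a‖ := by
    rintro z ⟨s, t, hs, ht, hst, rfl⟩
    have : s • a + t • b - a = t • (b - a) := by
      obtain rfl : s = 1 - t := by linarith
      module
    rw [this, norm_smul, Real.norm_of_nonneg ht]
    exact mul_le_of_le_one_left (norm_nonneg _) (by linarith)
  have h := Convex.norm_image_sub_le_of_norm_hasFDerivWithin_le' (f := f') (f' := f'')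
    (φ := f'' a) (C := C * ‖b - a‖) (s := segment ℝ a b) (x := a) (y := b)
    (fun z hz => (hf2 z (hseg hz)).hasFDerivWithinAt)
    (fun z hz => (hLip z (hseg hz) ((hdist z hz).trans_lt hr)).trans
      (mul_le_mul_of_nonneg_left (hdist z hz) hC))
    (convex_segment a b) (left_mem_segment ℝ a b) (right_mem_segment ℝ a b)
  calc _ ≤ _ := h
    _ = _ := by ring

theorem abs_taylor_two_le [CompleteSpace X] {f : X → ℝ} {f' : X → X} {f'' : X → X →L[ℝ] X}
    {D : Set X} (hD : Convex ℝ D) (hf1 : ∀ z ∈ D, HasGradientAt f (f' z) z)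
    (hf2 : ∀ z ∈ D, HasFDerivAt f' (f'' z) z) {a b : X} (ha : a ∈ D)
    (hb : b ∈ D) {C r : ℝ} (hC : 0 ≤ C)
    (hLip : ∀ z ∈ D, ‖z - a‖ < r → ‖f'' z - f'' a‖ ≤ C * ‖z - a‖) (hr : ‖b - a‖ < r) :
    |f b - (f a + ⟪f' a, b - a⟫_ℝ + 1/2 * ⟪b - a, f'' a (b - a)⟫_ℝ)| ≤ C * ‖b - a‖ ^ 3 := by
  have hmem : ∀ t ∈ Set.Icc (0:ℝ) 1, a + t • (b - a) ∈ D := fun t ht =>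
    hD.add_smul_sub_mem ha hb ht
  have hder : ∀ t ∈ Set.Icc (0:ℝ) 1, HasDerivWithinAt
      (fun t : ℝ => f (a + t • (b - a)) - t * ⟪f' a, b - a⟫_ℝ
        - t ^ 2 * (1/2 * ⟪b - a, f'' a (b - a)⟫_ℝ))
      (⟪f' (a + t • (b - a)) - f' a - f'' a (t • (b - a)), b - a⟫_ℝ) (Set.Icc 0 1) t := by
    intro t ht
    have h1 : HasDerivAt (fun t : ℝ => a + t • (b - a)) (b - a) t := by
      simpa using ((hasDerivAt_id t).smul_const (b - a)).const_add a
    have h2 : HasDerivAt (fun t : ℝ => f (a + t • (b - a)))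
        (⟪f' (a + t • (b - a)), b - a⟫_ℝ) t := by
      have := (hf1 _ (hmem t ht)).hasFDerivAt.comp_hasDerivAt t h1
      rw [InnerProductSpace.toDual_apply_apply] at this
      exact this
    have h3 := (h2.sub ((hasDerivAt_id t).mul_const ⟪f' a, b - a⟫_ℝ)).sub
      ((hasDerivAt_pow 2 t).mul_const (1/2 * ⟪b - a, f'' a (b - a)⟫_ℝ))
    refine (h3.congr_deriv ?_).hasDerivWithinAt
    rw [inner_sub_left (f' (a + t • (b - a)) - f' a), inner_sub_left (f' (a + t • (b - a))),
      map_smul, real_inner_smul_left, real_inner_comm (b - a) (f'' a (b - a))]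
    norm_num
    ring
  have hbd : ∀ t ∈ Set.Icc (0:ℝ) 1,
      ‖⟪f' (a + t • (b - a)) - f' a - f'' a (t • (b - a)), b - a⟫_ℝ‖ ≤ C * ‖b - a‖ ^ 3 := by
    intro t ht
    have hn : ‖a + t • (b - a) - a‖ ≤ ‖b - a‖ := by
      rw [add_sub_cancel_left, norm_smul, Real.norm_of_nonneg ht.1]
      exact mul_le_of_le_one_left (norm_nonneg _) ht.2
    have h1 := norm_gradient_taylor_le hD hf2 ha (hmem t ht) hC hLip (hn.trans_lt hr)
    have h2 : C * ‖a + t • (b - a) - a‖ ^ 2 ≤ C * ‖b - a‖ ^ 2 := by gcongr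
    rw [add_sub_cancel_left] at h1 h2
    calc _ ≤ ‖f' (a + t • (b - a)) - f' a - f'' a (t • (b - a))‖ * ‖b - a‖ :=
          norm_inner_le_norm _ _
      _ ≤ (C * ‖b - a‖ ^ 2) * ‖b - a‖ := by gcongr; exact h1.trans h2
      _ = _ := by ring
  have h := Convex.norm_image_sub_le_of_norm_hasDerivWithin_le hder hbd (convex_Icc 0 1)
    (Set.left_mem_Icc.2 zero_le_one) (Set.right_mem_Icc.2 zero_le_one)
  simp only [Real.norm_eq_abs] at h
  norm_num at h
  convert h using 2
  rw [map_sub]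
  ring

end Taylor

section Sequences

/-- If every cluster point of a bounded sequence has a neighbourhood on which a property holds
eventually for some witness, and witnesses can be merged, then one witness works eventually. -/
theorem exists_eventually_of_mapClusterPt {X ι : Type*} [PseudoMetricSpace X] [ProperSpace X]
    [Nonempty ι] {x : ℕ → X} (hx : Bornology.IsBounded (Set.range x)) {P : ι → ℕ → Prop}
    (merge : ι → ι → ι) (hl : ∀ a b k, P a k → P (merge a b) k)
    (hr : ∀ a b k, P b k → P (merge a b) k)
    (hloc : ∀ z, MapClusterPt z atTop x → ∃ U ∈ 𝓝 z, ∃ a, ∀ᶠ k in atTop, x k ∈ U → P a k) :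
    ∃ a, ∀ᶠ k in atTop, P a k := by
  have hK : IsCompact (closure (Set.range x)) := hx.isCompact_closure
  have h := hK.induction_on (p := fun s => ∃ a, ∀ᶠ k in atTop, x k ∈ s → P a k)
    ⟨Classical.arbitrary ι, by simp⟩
    (fun s t hst ⟨a, ha⟩ => ⟨a, ha.mono fun k hk hs => hk (hst hs)⟩)
    (fun s t ⟨a, ha⟩ ⟨b, hb⟩ => ⟨merge a b, by
      filter_upwards [ha, hb] with k h1 h2 h3
      exact h3.elim (fun h => hl _ _ _ (h1 h)) (fun h => hr _ _ _ (h2 h))⟩)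
    (fun z _ => by
      by_cases hz : MapClusterPt z atTop x
      · obtain ⟨U, hU, h⟩ := hloc z hz
        exact ⟨U, mem_nhdsWithin_of_mem_nhds hU, h⟩
      · rw [mapClusterPt_iff_frequently] at hz
        push Not at hz
        obtain ⟨U, hU, h⟩ := hz
        exact ⟨U, mem_nhdsWithin_of_mem_nhds hU, Classical.arbitrary ι,
          h.mono fun k hk hk' => absurd hk' hk⟩)
  obtain ⟨a, ha⟩ := h
  exact ⟨a, ha.mono fun k hk => hk (subset_closure (Set.mem_range_self k))⟩

theorem summable_of_succ_le_mul_add {e a : ℕ → ℝ} {θ : ℝ} (hθ : θ < 1)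
    (he : ∀ n, 0 ≤ e n) (ha : Summable a) (ha0 : ∀ n, 0 ≤ a n)
    (h : ∀ᶠ n in atTop, e (n + 1) ≤ θ * e n + a n) : Summable e := by
  obtain ⟨K, hK⟩ := eventually_atTop.1 h
  rw [← summable_nat_add_iff K]
  have ha' : Summable fun n => a (n + K) := (summable_nat_add_iff K).2 ha
  refine summable_of_sum_range_le (c := (e K + ∑' n, a (n + K)) / (1 - θ)) (fun n => he _)
    fun n => ?_
  rw [le_div_iff₀ (by linarith)]
  have h1 : ∑ i ∈ Finset.range n, e (i + 1 + K) ≤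
      θ * ∑ i ∈ Finset.range n, e (i + K) + ∑ i ∈ Finset.range n, a (i + K) := by
    rw [Finset.mul_sum, ← Finset.sum_add_distrib]
    refine Finset.sum_le_sum fun i _ => ?_
    have := hK (i + K) (by omega)
    rwa [show i + 1 + K = i + K + 1 by ring]
  have h2 : ∑ i ∈ Finset.range n, a (i + K) ≤ ∑' n, a (n + K) :=
    ha'.sum_le_tsum _ fun i _ => ha0 _
  have h3 : ∑ i ∈ Finset.range n, e (i + K) + e (n + K) =
      ∑ i ∈ Finset.range n, e (i + 1 + K) + e K := by
    rw [← Finset.sum_range_succ, Finset.sum_range_succ' (fun i => e (i + K))]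
    simp
  have := he (n + K)
  nlinarith

theorem le_young_of_rpow_le {q s t a : ℝ} (hq : 1 ≤ q) (hs : 0 ≤ s) (ht : 0 ≤ t) (ha : 0 ≤ a)
    (h : s ^ q ≤ t ^ (q - 1) * a) : s ≤ (1 - 1 / q) * t + 1 / q * a := by
  have hq0 : 0 < q := by linarith
  have h1 : 1 / q ≤ 1 := by rw [div_le_one hq0]; exact hq
  refine le_trans ?_ (Real.geom_mean_le_arith_mean2_weighted (w₁ := 1 - 1 / q) (w₂ := 1 / q)
    (by linarith) (by positivity) ht ha (by ring))
  have h2 : (s ^ q) ^ (1 / q) ≤ (t ^ (q - 1) * a) ^ (1 / q) :=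
    Real.rpow_le_rpow (by positivity) h (by positivity)
  rw [← Real.rpow_mul hs, mul_one_div_cancel hq0.ne', Real.rpow_one,
    Real.mul_rpow (by positivity) ha, ← Real.rpow_mul ht] at h2
  rwa [show 1 - 1 / q = (q - 1) * (1 / q) by field_simp]

theorem ConcaveOn.mul_sub_le_of_hasDerivAt {S : Set ℝ} {φ : ℝ → ℝ} (hφ : ConcaveOn ℝ S φ)
    {s t u c d : ℝ} (hs : s ∈ S) (ht : t ∈ S) (hu : u ∈ S) (hst : s < t) (htu : t ≤ u)
    (hd : HasDerivAt φ d t) (hc : HasDerivAt φ c u) : c * (t - s) ≤ φ t - φ s := by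
  have h1 : d ≤ slope φ s t := hφ.le_slope_of_hasDerivAt hs ht hst hd
  have h2 : c ≤ d := by
    rcases htu.eq_or_lt with rfl | h
    · exact (hc.unique hd).le
    · exact (hφ.le_slope_of_hasDerivAt ht hu h hc).trans (hφ.slope_le_of_hasDerivAt ht hu h hd)
  rw [slope_def_field, le_div_iff₀ (by linarith)] at h1
  nlinarith

/-- A desingularizing function sends a decreasing null sequence to one of finite variation. -/
theorem summable_abs_sub_desingularizing {φ φd : ℝ → ℝ} {ϖ : ℝ} (hϖ : 0 < ϖ)
    (hφ : ConcaveOn ℝ (Set.Ico 0 ϖ) φ)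
    (hd : ∀ t ∈ Set.Ioo 0 ϖ, HasDerivAt φ (φd t) t ∧ 0 < φd t) {t : ℕ → ℝ}
    (ht : ∀ n, 0 < t n) (hanti : ∀ n, t (n + 1) < t n) (hlim : Tendsto t atTop (𝓝 0)) :
    Summable fun n => |φ (t n) - φ (t (n + 1))| := by
  obtain ⟨K, hK⟩ := eventually_atTop.1 (hlim.eventually (gt_mem_nhds hϖ))
  have hmem : ∀ n, t (n + K) ∈ Set.Ico 0 ϖ := fun n => ⟨(ht _).le, hK _ (by omega)⟩
  have hdn : ∀ n, HasDerivAt φ (φd (t (n + K))) (t (n + K)) ∧ 0 < φd (t (n + K)) :=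
    fun n => hd _ ⟨ht _, hK _ (by omega)⟩
  have hmono : ∀ n, φ (t (n + 1 + K)) ≤ φ (t (n + K)) := by
    intro n
    have hlt : t (n + 1 + K) < t (n + K) := by
      rw [show n + 1 + K = n + K + 1 by ring]; exact hanti _
    have := hφ.mul_sub_le_of_hasDerivAt (hmem (n + 1)) (hmem n) (hmem n) hlt le_rfl
      (hdn n).1 (hdn n).1
    have := mul_nonneg (hdn n).2.le (sub_nonneg.2 hlt.le)
    linarith
  have hpos : ∀ n, φ 0 ≤ φ (t (n + K)) := by
    intro n
    have := hφ.mul_sub_le_of_hasDerivAt ⟨le_rfl, hϖ⟩ (hmem n) (hmem n) (ht _) le_rfl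
      (hdn n).1 (hdn n).1
    have := mul_nonneg (hdn n).2.le (sub_nonneg.2 (ht (n + K)).le)
    linarith
  rw [← summable_nat_add_iff K]
  have heq : (fun n => |φ (t (n + K)) - φ (t (n + K + 1))|) =
      fun n => φ (t (n + K)) - φ (t (n + 1 + K)) := by
    funext n
    rw [show n + K + 1 = n + 1 + K by ring, abs_of_nonneg (sub_nonneg.2 (hmono n))]
  rw [heq]
  refine summable_of_sum_range_le (c := φ (t (0 + K)) - φ 0)
    (fun n => sub_nonneg.2 (hmono n)) fun n => ?_
  rw [Finset.sum_range_sub' (fun n => φ (t (n + K)))]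
  linarith [hpos n]

end Sequences

section Descent

/-- Sufficient decrease together with the Kurdyka–Łojasiewicz inequality along nearby points
forces the step lengths to be summable. -/
theorem summable_of_descent_of_KL {X : Type*} [PseudoMetricSpace X] [ProperSpace X]
    {x y : ℕ → X} (hx : Bornology.IsBounded (Set.range x)) {d Fx Fy : ℕ → ℝ} {q c M Fs : ℝ}
    (hq : 1 < q) (hc : 0 < c) (hM : 0 ≤ M) (hd : ∀ k, 0 < d k)
    (hdesc : ∀ k, c * d k ^ q ≤ Fx k - Fx (k + 1)) (hFxy : ∀ k, Fx (k + 1) ≤ Fy k)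
    (hFx : Tendsto Fx atTop (𝓝 Fs)) (hFy : Tendsto Fy atTop (𝓝 Fs))
    (hxy : Tendsto (fun k => dist (y k) (x k)) atTop (𝓝 0))
    (hKL : ∀ z, MapClusterPt z atTop x → ∃ δ : ℝ, 0 < δ ∧ ∃ ϖ : ℝ, 0 < ϖ ∧ ∃ φ φd : ℝ → ℝ,
      ConcaveOn ℝ (Set.Ico 0 ϖ) φ ∧ (∀ t ∈ Set.Ioo 0 ϖ, HasDerivAt φ (φd t) t ∧ 0 < φd t) ∧
      ∀ᶠ k in atTop, dist (y k) z < δ → Fs < Fy k → Fy k < Fs + ϖ →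
        1 ≤ φd (Fy k - Fs) * (M * d k ^ (q - 1))) :
    Summable d := by
  have hanti : ∀ k, Fx (k + 1) < Fx k := fun k => by
    have := mul_pos hc (Real.rpow_pos_of_pos (hd k) q)
    linarith [hdesc k]
  have hgt : ∀ k, Fs < Fx k := fun k =>
    ((strictAnti_nat_of_succ_lt hanti).antitone.le_of_tendsto hFx (k + 1)).trans_lt (hanti k)
  let ι := {a : ℕ → ℝ // Summable a ∧ ∀ n, 0 ≤ a n}
  have : Nonempty ι := ⟨⟨0, summable_zero, fun _ => le_rfl⟩⟩
  obtain ⟨⟨a, ha, ha0⟩, h⟩ := exists_eventually_of_mapClusterPt (ι := ι) hx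
    (P := fun a k => d (k + 1) ^ q ≤ d k ^ (q - 1) * a.1 k)
    (fun a b => ⟨fun n => a.1 n + b.1 n, a.2.1.add b.2.1, fun n => add_nonneg (a.2.2 n) (b.2.2 n)⟩)
    (fun a b k hk => hk.trans (mul_le_mul_of_nonneg_left
      (le_add_of_nonneg_right (b.2.2 k)) (Real.rpow_nonneg (hd k).le _)))
    (fun a b k hk => hk.trans (mul_le_mul_of_nonneg_left
      (le_add_of_nonneg_left (a.2.2 k)) (Real.rpow_nonneg (hd k).le _)))
    (fun z hz => by
      obtain ⟨δ, hδ, ϖ, hϖ, φ, φd, hφ, hφd, hineq⟩ := hKL z hz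
      have hlim : Tendsto (fun n => Fx (n + 1) - Fs) atTop (𝓝 0) := by
        have := ((tendsto_add_atTop_iff_nat 1).2 hFx).sub_const Fs
        rwa [sub_self] at this
      have hsum := summable_abs_sub_desingularizing hϖ hφ hφd
        (t := fun n => Fx (n + 1) - Fs) (fun n => sub_pos.2 (hgt _))
        (fun n => sub_lt_sub_right (hanti _) _) hlim
      refine ⟨Metric.ball z (δ / 2), Metric.ball_mem_nhds z (by positivity),
        ⟨fun n => M / c * |φ (Fx (n + 1) - Fs) - φ (Fx (n + 1 + 1) - Fs)|, hsum.mul_left _,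
          fun n => by positivity⟩, ?_⟩
      filter_upwards [hineq, hxy.eventually (gt_mem_nhds (half_pos hδ)),
        hFy.eventually (gt_mem_nhds (lt_add_of_pos_right Fs hϖ))] with k h1 h2 h3 h4
      have h4' : dist (x k) z < δ / 2 := h4
      have h5 : dist (y k) z < δ := by
        have := dist_triangle (y k) (x k) z
        linarith
      have h6 : Fs < Fy k := (hgt _).trans_le (hFxy k)
      have h7 := h1 h5 h6 h3
      have h8 := hgt (k + 1 + 1)
      have h9 := hanti (k + 1)
      have h10 := hFxy k
      have h11 := hφ.mul_sub_le_of_hasDerivAt (s := Fx (k + 1 + 1) - Fs) (t := Fx (k + 1) - Fs)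
        (u := Fy k - Fs) ⟨by linarith, by linarith⟩ ⟨by linarith, by linarith⟩
        ⟨by linarith, by linarith⟩ (by linarith) (by linarith)
        (hφd _ ⟨by linarith, by linarith⟩).1 (hφd _ ⟨by linarith, by linarith⟩).1
      have hD := Real.rpow_pos_of_pos (hd k) (q - 1)
      have h12 : c * d (k + 1) ^ q ≤ M * d k ^ (q - 1) *
          |φ (Fx (k + 1) - Fs) - φ (Fx (k + 1 + 1) - Fs)| := by
        calc c * d (k + 1) ^ q ≤ Fx (k + 1) - Fx (k + 1 + 1) := hdesc (k + 1)
          _ ≤ (Fx (k + 1) - Fx (k + 1 + 1)) * (φd (Fy k - Fs) * (M * d k ^ (q - 1))) :=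
            le_mul_of_one_le_right (by linarith) h7
          _ = M * d k ^ (q - 1) *
              (φd (Fy k - Fs) * (Fx (k + 1) - Fs - (Fx (k + 1 + 1) - Fs))) := by ring
          _ ≤ _ := mul_le_mul_of_nonneg_left (h11.trans (le_abs_self _)) (by positivity)
      change d (k + 1) ^ q ≤ d k ^ (q - 1) * (M / c * _)
      rw [← mul_le_mul_iff_right₀ hc]
      refine h12.trans (le_of_eq ?_)
      field_simp)
  have hq0 : 0 < q := by linarith
  refine summable_of_succ_le_mul_add (θ := 1 - 1 / q) (a := fun k => 1 / q * a k)
    (by linarith [one_div_pos.2 hq0]) (fun k => (hd k).le) (ha.mul_left _)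
    (fun n => mul_nonneg (by positivity) (ha0 n)) ?_
  filter_upwards [h] with k hk
  exact le_young_of_rpow_le hq.le (hd _).le (hd _).le (ha0 k) hk

end Descent

section LocalControl

variable {X : Type*} [NormedAddCommGroup X] [InnerProductSpace ℝ X]

/-- Quantitative control of `f` and its first two derivatives near `a`, relative to the effective
domain of `g`. -/
structure LocalControl (g : X → EReal) (f : X → ℝ) (f' : X → X) (f'' : X → X →L[ℝ] X) (C : ℝ)
    (a : X) : Prop where
  one_le : 1 ≤ C
  grad : ‖f' a‖ ≤ C
  hess : ‖f'' a‖ ≤ C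
  lower : -C ≤ f a
  lip : ∀ b, g b ≠ ⊤ → ‖b - a‖ < 1 / C → ‖f'' b - f'' a‖ ≤ C * ‖b - a‖

variable {g : X → EReal} {f : X → ℝ} {f' : X → X} {f'' : X → X →L[ℝ] X} {C : ℝ} {a : X}

theorem LocalControl.mono {C' : ℝ} (h : LocalControl g f f' f'' C a) (hC : C ≤ C') :
    LocalControl g f f' f'' C' a where
  one_le := h.one_le.trans hC
  grad := h.grad.trans hC
  hess := h.hess.trans hC
  lower := (neg_le_neg hC).trans h.lower
  lip b hb hba := (h.lip b hb (hba.trans_le (one_div_le_one_div_of_le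
    (zero_lt_one.trans_le h.one_le) hC))).trans (mul_le_mul_of_nonneg_right hC (norm_nonneg _))

theorem exists_nhds_localControl {z : X} (hf : ContinuousAt f z) (hf' : ContinuousAt f' z)
    (hf'' : ContinuousAt f'' z) {N : Set X} (hN : N ∈ 𝓝 z) {K δ : ℝ} (hδ : 0 < δ)
    (hlip : ∀ a ∈ Metric.ball z δ ∩ N, ∀ b ∈ Metric.ball z δ ∩ N,
      ‖f'' a - f'' b‖ ≤ K * ‖a - b‖) :
    ∃ U ∈ 𝓝 z, ∃ C, ∀ a ∈ U, LocalControl g f f' f'' C a := by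
  obtain ⟨ε, hε, hεN⟩ := Metric.mem_nhds_iff.1 hN
  set r := min δ ε with hr
  have hr0 : 0 < r := lt_min hδ hε
  have hball : Metric.ball z r ⊆ Metric.ball z δ ∩ N := fun u hu =>
    ⟨Metric.ball_subset_ball (min_le_left _ _) hu,
      hεN (Metric.ball_subset_ball (min_le_right _ _) hu)⟩
  have h1 : ∀ᶠ a in 𝓝 z, ‖f' a‖ < ‖f' z‖ + 1 :=
    hf'.norm.eventually (gt_mem_nhds (lt_add_one _))
  have h2 : ∀ᶠ a in 𝓝 z, ‖f'' a‖ < ‖f'' z‖ + 1 :=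
    hf''.norm.eventually (gt_mem_nhds (lt_add_one _))
  have h3 : ∀ᶠ a in 𝓝 z, f z - 1 < f a := hf.eventually (lt_mem_nhds (sub_one_lt _))
  refine ⟨_, (h1.and (h2.and (h3.and (Metric.ball_mem_nhds z (half_pos hr0))))),
    1 + ‖f' z‖ + ‖f'' z‖ + |f z| + 2 / r + |K|, ?_⟩
  rintro a ⟨ha1, ha2, ha3, ha4⟩
  have n1 := norm_nonneg (f' z)
  have n2 := norm_nonneg (f'' z)
  have n3 := abs_nonneg (f z)
  have n4 := neg_abs_le (f z)
  have n5 := abs_nonneg K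
  have n6 : 0 < 2 / r := by positivity
  refine ⟨by linarith, by linarith, by linarith, by linarith, fun b _ hb => ?_⟩
  have ha5 : dist a z < r / 2 := ha4
  have hb1 : ‖b - a‖ < r / 2 := by
    refine hb.trans_le ?_
    rw [one_div_le (by linarith) (by positivity), one_div_div]
    linarith
  have hb2 : dist b z < r := by
    have := dist_triangle b a z
    rw [dist_eq_norm b a] at this
    linarith
  refine (hlip b (hball hb2) a (hball (show dist a z < r by linarith))).trans ?_
  refine mul_le_mul_of_nonneg_right ?_ (norm_nonneg _)
  linarith [le_abs_self K]

/-- Cluster points of a sequence with bounded objective values stay in the effective domain when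
the Hessian is bounded nearby. -/
theorem ne_top_of_mapClusterPt [CompleteSpace X] (hbot : ∀ z, g z ≠ ⊥)
    (hlsc : LowerSemicontinuous g)
    (hD : Convex ℝ {z | g z ≠ ⊤}) (hf1 : ∀ z, g z ≠ ⊤ → HasGradientAt f (f' z) z)
    (hf2 : ∀ z, g z ≠ ⊤ → HasFDerivAt f' (f'' z) z) {x : ℕ → X} (hx : ∀ k, g (x k) ≠ ⊤) {B : ℝ}
    (hB : ∀ k, f (x k) + (g (x k)).toReal ≤ B) {z : X} (hz : MapClusterPt z atTop x) {δ K : ℝ}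
    (hδ : 0 < δ) (hK : ∀ a ∈ Metric.ball z δ, ‖f'' a‖ ≤ K) : g z ≠ ⊤ := by
  obtain ⟨ψ, -, hψ⟩ := hz.tendsto_subseq
  obtain ⟨n₀, hn₀⟩ := eventually_atTop.1 (hψ.eventually (Metric.ball_mem_nhds z hδ))
  set S := {z | g z ≠ ⊤} ∩ Metric.ball z δ
  have hS : Convex ℝ S := hD.inter (convex_ball z δ)
  set a₀ := x (ψ n₀)
  have ha₀ : a₀ ∈ S := ⟨hx _, hn₀ n₀ le_rfl⟩
  have hK0 : 0 ≤ K := (norm_nonneg _).trans (hK _ ha₀.2)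
  have hdist : ∀ a ∈ S, ‖a - a₀‖ ≤ 2 * δ := by
    intro a ha
    have h1 : dist a z < δ := ha.2
    have h2 : dist a₀ z < δ := ha₀.2
    rw [← dist_eq_norm]
    linarith [dist_triangle_right a a₀ z]
  have hgrad : ∀ a ∈ S, ‖f' a‖ ≤ ‖f' a₀‖ + K * (2 * δ) := by
    intro a ha
    have h1 := hS.norm_image_sub_le_of_norm_hasFDerivWithin_le
      (fun u hu => (hf2 u hu.1).hasFDerivWithinAt) (fun u hu => hK u hu.2) ha₀ ha
    have h2 := norm_le_norm_add_norm_sub' (f' a) (f' a₀)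
    have h3 := mul_le_mul_of_nonneg_left (hdist a ha) hK0
    linarith
  set G := ‖f' a₀‖ + K * (2 * δ)
  have hG0 : 0 ≤ G := by positivity
  have hval : ∀ a ∈ S, f a₀ - G * (2 * δ) ≤ f a := by
    intro a ha
    have h1 := hS.norm_image_sub_le_of_norm_hasFDerivWithin_le
      (fun u hu => (hf1 u hu.1).hasFDerivAt.hasFDerivWithinAt)
      (fun u hu => ((InnerProductSpace.toDual ℝ X).norm_map _).trans_le (hgrad u hu)) ha₀ ha
    have h3 := mul_le_mul_of_nonneg_left (hdist a ha) hG0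
    rw [Real.norm_eq_abs] at h1
    linarith [neg_abs_le (f a - f a₀)]
  have := hlsc.le_coe_of_tendsto (u := fun n => x (ψ (n + n₀)))
    ((tendsto_add_atTop_iff_nat n₀).2 hψ)
    (c := fun _ => B - (f a₀ - G * (2 * δ))) tendsto_const_nhds (fun n => by
      rw [← EReal.coe_toReal (hx (ψ (n + n₀))) (hbot _), EReal.coe_le_coe_iff]
      have h1 := hval _ ⟨hx (ψ (n + n₀)), hn₀ (n + n₀) (by omega)⟩
      have h2 := hB (ψ (n + n₀))
      linarith)
  exact ne_top_of_le_ne_top (EReal.coe_ne_top _) this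

/-- A regularization weight for which an inexact model minimizer fails the descent test is
bounded. -/
theorem LocalControl.weight_le_of_descent_fails [CompleteSpace X]
    (h : LocalControl g f f' f'' C a)
    (hD : Convex ℝ {z | g z ≠ ⊤}) (hf1 : ∀ z, g z ≠ ⊤ → HasGradientAt f (f' z) z)
    (hf2 : ∀ z, g z ≠ ⊤ → HasFDerivAt f' (f'' z) z) (ha : g a ≠ ⊤) {b : X} (hb : g b ≠ ⊤)
    {A l q σ : ℝ} (hA : 0 ≤ A) (hq2 : 2 ≤ q) (hq3 : q ≤ 3) (hσ : σ < 1)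
    (hmin : -(A * (1 + ‖b - a‖)) ≤ (g b).toReal) (hga : (g a).toReal ≤ A)
    (hmodel : ⟪f' a, b - a⟫_ℝ + 1/2 * ⟪b - a, f'' a (b - a)⟫_ℝ + l / q * ‖b - a‖ ^ q
      + (g b).toReal < (g a).toReal)
    (hfail : f a + (g a).toReal - σ * l / q * ‖b - a‖ ^ q < f b + (g b).toReal) :
    l ≤ 3 * (2 * A + C) * q * C ^ 3 + C * q / (1 - σ) := by
  have hC1 := h.one_le
  have hC0 : 0 < C := by linarith
  have hq0 : 0 < q := by linarith
  have hσ' : 0 < 1 - σ := by linarith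
  have p1 : 0 ≤ 3 * (2 * A + C) * q * C ^ 3 := by positivity
  have p2 : 0 ≤ C * q / (1 - σ) := by positivity
  set s := ‖b - a‖ with hs
  have hs0 : 0 < s := by
    rw [hs, norm_pos_iff, sub_ne_zero]
    rintro rfl
    simp [hs, Real.zero_rpow hq0.ne'] at hmodel
  by_cases hsC : s < 1 / C
  · have h1 := abs_taylor_two_le hD (fun z hz => hf1 z hz) (fun z hz => hf2 z hz) ha hb hC0.le
      (fun z hz hza => h.lip z hz hza) hsC
    have h2 := (le_abs_self _).trans h1
    have h3 : (1 - σ) * l / q * s ^ q ≤ C * s ^ 3 := by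
      have : (1 - σ) * l / q * s ^ q = l / q * s ^ q - σ * l / q * s ^ q := by ring
      linarith
    have hs1 : s ≤ 1 := hsC.le.trans (by rw [div_le_one hC0]; exact hC1)
    have h4 : s ^ (3 : ℕ) ≤ s ^ q := by
      rw [← Real.rpow_natCast]
      exact Real.rpow_le_rpow_of_exponent_ge hs0 hs1 (by exact_mod_cast hq3)
    have h5 : (1 - σ) * l / q * s ^ q ≤ C * s ^ q :=
      h3.trans (mul_le_mul_of_nonneg_left h4 hC0.le)
    have h6 := le_of_mul_le_mul_right h5 (Real.rpow_pos_of_pos hs0 q)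
    rw [div_le_iff₀ hq0] at h6
    have : l ≤ C * q / (1 - σ) := by rw [le_div_iff₀ hσ']; linarith
    linarith
  · push Not at hsC
    have hCs : 1 ≤ C * s := by rwa [div_le_iff₀' hC0] at hsC
    have h1 : -(C * s) ≤ ⟪f' a, b - a⟫_ℝ := by
      have h1 := abs_real_inner_le_norm (f' a) (b - a)
      have h2 := mul_le_mul_of_nonneg_right h.grad hs0.le
      linarith [neg_abs_le ⟪f' a, b - a⟫_ℝ]
    have h2 : -(C * s ^ 2) ≤ ⟪b - a, f'' a (b - a)⟫_ℝ := by
      have h1 := abs_real_inner_le_norm (b - a) (f'' a (b - a))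
      have h2 : ‖f'' a (b - a)‖ ≤ C * s := (f'' a).le_of_opNorm_le h.hess _
      have h3 := mul_le_mul_of_nonneg_left h2 hs0.le
      linarith [neg_abs_le ⟪b - a, f'' a (b - a)⟫_ℝ]
    have h3 : l / q * s ^ q ≤ (2 * A + C) * (1 + s + s ^ 2) := by nlinarith
    have h4 : 1 + s + s ^ 2 ≤ 3 * C ^ 2 * s ^ 2 := by
      have e1 := mul_le_mul_of_nonneg_left hCs hs0.le
      have e2 := mul_le_mul_of_nonneg_left hCs (by positivity : 0 ≤ C * s)
      have e3 := mul_le_mul_of_nonneg_left hC1 (by positivity : 0 ≤ C * s ^ 2)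
      have e4 := mul_le_mul_of_nonneg_left hC1 (by positivity : 0 ≤ s ^ 2)
      linarith
    have h5 : s ^ 2 ≤ C * s ^ q := by
      have h6 : s ^ q = s ^ 2 * s ^ (q - 2) := by
        rw [← Real.rpow_natCast, ← Real.rpow_add hs0]; norm_num
      have h7 : 1 / C ≤ s ^ (q - 2) := by
        rcases le_total s 1 with h1 | h1
        · refine hsC.trans ?_
          conv_lhs => rw [← Real.rpow_one s]
          exact Real.rpow_le_rpow_of_exponent_ge hs0 h1 (by linarith)
        · refine le_trans ?_ (Real.one_le_rpow h1 (by linarith))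
          rw [div_le_one hC0]; exact hC1
      rw [div_le_iff₀' hC0] at h7
      rw [h6]
      nlinarith [sq_nonneg s]
    have h6 : l / q * s ^ q ≤ (2 * A + C) * (3 * C ^ 2 * (C * s ^ q)) :=
      h3.trans (mul_le_mul_of_nonneg_left (h4.trans
        (mul_le_mul_of_nonneg_left h5 (by positivity))) (by positivity))
    have h7 : l / q ≤ 3 * (2 * A + C) * C ^ 3 :=
      le_of_mul_le_mul_right (h6.trans_eq (by ring)) (Real.rpow_pos_of_pos hs0 q)
    rw [div_le_iff₀ hq0] at h7
    linarith

/-- The subgradient produced by an inexact proximal step is small relative to the step length. -/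
theorem LocalControl.norm_grad_add_subgrad_le (h : LocalControl g f f' f'' C a)
    (hD : Convex ℝ {z | g z ≠ ⊤}) (hf2 : ∀ z, g z ≠ ⊤ → HasFDerivAt f' (f'' z) z)
    (ha : g a ≠ ⊤) {b v : X} (hbv : g (b - v) ≠ ⊤) {l q M : ℝ} (hq2 : 2 ≤ q) (hq3 : q ≤ 3)
    (hl : 0 ≤ l) (hlM : l ≤ M) (hb0 : 0 < ‖b - a‖) (hb1 : ‖b - a‖ ≤ 1)
    (hv : ‖v‖ ≤ M * ‖b - a‖ ^ (q - 1)) (hbva : ‖b - v - a‖ < 1 / C) :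
    ‖f' (b - v) + (v - (f' a + f'' a (b - a) + (l * ‖b - a‖ ^ (q - 2)) • (b - a)))‖ ≤
      (C * (1 + M) ^ 2 + C * M + 2 * M) * ‖b - a‖ ^ (q - 1) := by
  have hC0 : 0 < C := by linarith [h.one_le]
  have hM : 0 ≤ M := hl.trans hlM
  set s := ‖b - a‖ with hs
  have h1 := norm_gradient_taylor_le hD (fun z hz => hf2 z hz) ha hbv hC0.le
    (fun z hz hza => h.lip z hz hza) hbva
  have hp : s ^ (q - 1) ≤ s := by
    conv_rhs => rw [← Real.rpow_one s]
    exact Real.rpow_le_rpow_of_exponent_ge hb0 hb1 (by linarith)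
  have hp2 : s ^ 2 ≤ s ^ (q - 1) := by
    rw [← Real.rpow_natCast]
    exact Real.rpow_le_rpow_of_exponent_ge hb0 hb1 (by push_cast; linarith)
  have hp3 : s ^ (q - 2) * s = s ^ (q - 1) := by
    nth_rewrite 2 [← Real.rpow_one s]
    rw [← Real.rpow_add hb0]; ring_nf
  have h2 : ‖b - v - a‖ ≤ (1 + M) * s := by
    have : b - v - a = (b - a) - v := by abel
    rw [this]
    have := norm_sub_le (b - a) v
    nlinarith
  have h3 : C * ‖b - v - a‖ ^ 2 ≤ C * (1 + M) ^ 2 * s ^ (q - 1) := by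
    calc _ ≤ C * ((1 + M) * s) ^ 2 := by gcongr
      _ = C * (1 + M) ^ 2 * s ^ 2 := by ring
      _ ≤ _ := by gcongr
  have h4 : ‖f'' a v‖ ≤ C * M * s ^ (q - 1) := by
    calc _ ≤ C * ‖v‖ := (f'' a).le_of_opNorm_le h.hess _
      _ ≤ C * (M * s ^ (q - 1)) := by gcongr
      _ = _ := by ring
  have h5 : ‖(l * s ^ (q - 2)) • (b - a)‖ ≤ M * s ^ (q - 1) := by
    rw [norm_smul, Real.norm_of_nonneg (by positivity), ← hs, mul_assoc, hp3]
    gcongr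
  have heq : f' (b - v) + (v - (f' a + f'' a (b - a) + (l * s ^ (q - 2)) • (b - a))) =
      (f' (b - v) - f' a - f'' a (b - v - a)) - f'' a v + v - (l * s ^ (q - 2)) • (b - a) := by
    simp only [map_sub]
    abel
  rw [heq]
  have t1 := norm_sub_le ((f' (b - v) - f' a - f'' a (b - v - a)) - f'' a v + v)
    ((l * s ^ (q - 2)) • (b - a))
  have t2 := norm_add_le ((f' (b - v) - f' a - f'' a (b - v - a)) - f'' a v) v
  have t3 := norm_sub_le (f' (b - v) - f' a - f'' a (b - v - a)) (f'' a v)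
  linarith

/-- Local Lipschitz estimate for the smooth part. -/
theorem LocalControl.abs_sub_le [CompleteSpace X] (h : LocalControl g f f' f'' C a)
    (hD : Convex ℝ {z | g z ≠ ⊤}) (hf1 : ∀ z, g z ≠ ⊤ → HasGradientAt f (f' z) z)
    (hf2 : ∀ z, g z ≠ ⊤ → HasFDerivAt f' (f'' z) z) (ha : g a ≠ ⊤) {b : X} (hb : g b ≠ ⊤)
    (hba : ‖b - a‖ < 1 / C) : |f b - f a| ≤ 3 * C * ‖b - a‖ := by
  have hC0 : 0 < C := by linarith [h.one_le]
  have h0 := abs_taylor_two_le hD (fun z hz => hf1 z hz) (fun z hz => hf2 z hz) ha hb hC0.le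
      (fun z hz hza => h.lip z hz hza) hba
  set s := ‖b - a‖ with hs
  have hs0 : 0 ≤ s := norm_nonneg _
  have hs1 : s ≤ 1 := hba.le.trans (by rw [div_le_one hC0]; exact h.one_le)
  have h1 := abs_real_inner_le_norm (f' a) (b - a)
  have h2 := mul_le_mul_of_nonneg_right h.grad hs0
  have h3 := abs_real_inner_le_norm (b - a) (f'' a (b - a))
  have h4 : ‖f'' a (b - a)‖ ≤ C * s := (f'' a).le_of_opNorm_le h.hess _
  have h5 := mul_le_mul_of_nonneg_left h4 hs0
  have h6 : s ^ 2 ≤ s := by nlinarith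
  have h7 : s ^ 3 ≤ s := by nlinarith
  have h8 := mul_le_mul_of_nonneg_left h6 hC0.le
  have h9 := mul_le_mul_of_nonneg_left h7 hC0.le
  rw [abs_le] at h0 h1 h3 ⊢
  have h10 : 0 ≤ C * s := by positivity
  have h11 : s * (C * s) = C * s ^ 2 := by ring
  constructor <;> linarith

end LocalControl

/-- Theorem 4.1: under Assumption 2, if F is a KL function then the iterate sequence of
Algorithm 1 has finite length and converges to a stationary point. -/
theorem global_convergence_KL
    {X : Type*} [NormedAddCommGroup X] [InnerProductSpace ℝ X] [FiniteDimensional ℝ X]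
    -- the data of problem (1): f twice continuously differentiable on an open set O ⊇ dom g,
    -- g proper lsc convex, F = f + g bounded below
    (f : X → ℝ) (g : X → EReal) (f' : X → X) (f'' : X → X →L[ℝ] X)
    (O : Set X) (hO : IsOpen O) (hOdom : {z : X | g z ≠ ⊤} ⊆ O)
    (hgproper : ∃ z : X, g z ≠ ⊤) (hgnebot : ∀ z : X, g z ≠ ⊥)
    (hglsc : LowerSemicontinuous g)
    (hgconv : ∀ u w : X, ∀ t : ℝ, t ∈ Set.Ioo (0:ℝ) 1 →
        g (t • u + (1 - t) • w) ≤ (t : EReal) * g u + ((1 - t : ℝ) : EReal) * g w)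
    (hf1 : ∀ z ∈ O, HasGradientAt f (f' z) z)
    (hf2 : ∀ z ∈ O, HasFDerivAt f' (f'' z) z)
    (hf2c : ContinuousOn f'' O)
    -- the proximal mapping of g
    (proxg : X → X)
    (hproxg : ∀ w z : X,
        ((1/2 * ‖proxg w - w‖ ^ 2 : ℝ) : EReal) + g (proxg w) ≤
          ((1/2 * ‖z - w‖ ^ 2 : ℝ) : EReal) + g z)
    (F : X → EReal) (hF : ∀ z : X, F z = (f z : EReal) + g z)
    (hFbdd : ∃ m : ℝ, ∀ z : X, (m : EReal) ≤ F z)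
    -- Algorithm 1 parameters
    (q Lmin Lmax ϱ σ τ : ℝ)
    (hq : q ∈ Set.Icc (2:ℝ) 3) (hLmin : 0 < Lmin) (hLmm : Lmin < Lmax)
    (hϱ : ϱ ∈ Set.Ioo (0:ℝ) 1) (hσ : σ ∈ Set.Ioo (0:ℝ) 1) (hτ : 1 < τ)
    -- the sequences generated by Algorithm 1
    (x y v : ℕ → X) (L L0 : ℕ → ℝ) (j : ℕ → ℕ)
    (hx0 : g (x 0) ≠ ⊤)
    (hL0 : ∀ k : ℕ, L0 k ∈ Set.Icc Lmin Lmax)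
    (hLdef : ∀ k : ℕ, L k = τ ^ j k * L0 k)
    -- the quadratic model ϑ_k, the regularized model objective Θ_{k,L} and its KKT residual map
    (ϑ : ℕ → X → ℝ)
    (hϑ : ∀ k : ℕ, ∀ z : X, ϑ k z = f (x k) + ⟪f' (x k), z - x k⟫_ℝ
        + 1/2 * ⟪z - x k, f'' (x k) (z - x k)⟫_ℝ)
    (Θ : ℕ → ℝ → X → EReal)
    (hΘ : ∀ k : ℕ, ∀ l : ℝ, ∀ z : X,
        Θ k l z = ((ϑ k z + l / q * ‖z - x k‖ ^ q : ℝ) : EReal) + g z)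
    (Rk : ℕ → ℝ → X → X)
    (hRk : ∀ k : ℕ, ∀ l : ℝ, ∀ z : X, Rk k l z = z - proxg (z -
        (f' (x k) + f'' (x k) (z - x k) + (l * ‖z - x k‖ ^ (q - 2)) • (z - x k))))
    -- inexactness criterion and descent condition at each iteration
    (hydom : ∀ k : ℕ, g (y k) ≠ ⊤)
    (hinex1 : ∀ k : ℕ, ‖Rk k (L k) (y k)‖ ≤ ϱ * L k * ‖y k - x k‖ ^ (q - 1))
    (hinex2 : ∀ k : ℕ, Θ k (L k) (y k) < Θ k (L k) (x k))
    (hdesc : ∀ k : ℕ, F (y k) ≤ F (x k) - ((σ * L k / q * ‖y k - x k‖ ^ q : ℝ) : EReal))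
    (hv : ∀ k : ℕ, v k = Rk k (L k) (y k))
    (hxsucc : ∀ k : ℕ, x (k + 1) = if F (y k) < F (y k - v k) then y k else y k - v k)
    -- if j_k ≥ 1, the previous trial point failed the descent test
    (hback : ∀ k : ℕ, 1 ≤ j k → ∃ yt : X, g yt ≠ ⊤ ∧
        ‖Rk k (L k / τ) yt‖ ≤ ϱ * (L k / τ) * ‖yt - x k‖ ^ (q - 1) ∧
        Θ k (L k / τ) yt < Θ k (L k / τ) (x k) ∧
        F (x k) - ((σ * (L k / τ) / q * ‖yt - x k‖ ^ q : ℝ) : EReal) < F yt)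
    -- Assumption 2: bounded level set; ∇²f locally Lipschitz on an open convex set N ⊇ ω(x⁰)
    (hlevel : Bornology.IsBounded {z : X | F z ≤ F (x 0)})
    (N : Set X) (hNopen : IsOpen N) (hNconv : Convex ℝ N)
    (hNomega : {z : X | MapClusterPt z atTop x} ⊆ N)
    (hHloc : ∀ z ∈ N, ∃ K : ℝ, 0 < K ∧ ∃ δ : ℝ, 0 < δ ∧
        ∀ a ∈ Metric.ball z δ ∩ N, ∀ b ∈ Metric.ball z δ ∩ N,
          ‖f'' a - f'' b‖ ≤ K * ‖a - b‖)
    -- F is a KL function (with respect to the subdifferential ∇f + ∂g)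
    (hKL : ∀ xc : X, (ESubdiff g xc).Nonempty →
        ∃ δ : ℝ, 0 < δ ∧ ∃ ϖ : EReal, 0 < ϖ ∧ ∃ φ φd : ℝ → ℝ,
          φ 0 = 0 ∧
          ContinuousOn φ {t : ℝ | 0 ≤ t ∧ (t : EReal) < ϖ} ∧
          ConcaveOn ℝ {t : ℝ | 0 ≤ t ∧ (t : EReal) < ϖ} φ ∧
          (∀ t : ℝ, 0 < t → (t : EReal) < ϖ → HasDerivAt φ (φd t) t ∧ 0 < φd t) ∧
          ContinuousOn φd {t : ℝ | 0 < t ∧ (t : EReal) < ϖ} ∧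
          (∀ z ∈ Metric.ball xc δ, F xc < F z → F z < F xc + ϖ →
            ∀ w ∈ ESubdiff g z, 1 ≤ φd (F z - F xc).toReal * ‖f' z + w‖)) :
    (Summable fun k : ℕ => ‖x (k + 1) - x k‖) ∧
    ∃ xb : X, -f' xb ∈ ESubdiff g xb ∧ Tendsto x atTop (𝓝 xb) := by
  have hq2 := hq.1
  have hq3 := hq.2
  have hq0 : 0 < q := by linarith
  have hD := convex_setOf_ne_top hgnebot hgconv
  have hf1D : ∀ z, g z ≠ ⊤ → HasGradientAt f (f' z) z := fun z hz => hf1 z (hOdom hz)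
  have hf2D : ∀ z, g z ≠ ⊤ → HasFDerivAt f' (f'' z) z := fun z hz => hf2 z (hOdom hz)
  have hFr : ∀ z, g z ≠ ⊤ → F z = ((f z + (g z).toReal : ℝ) : EReal) := fun z hz => by
    rw [hF, EReal.coe_add, EReal.coe_toReal hz (hgnebot z)]
  have hprox := fun w => sub_mem_eSubdiff_of_prox hgnebot hgproper hgconv (hproxg w)
  -- the proximal points and their subgradients
  obtain ⟨u, hu⟩ : ∃ u : ℕ → X, ∀ k, u k = y k - v k := ⟨_, fun _ => rfl⟩
  obtain ⟨w, hw⟩ : ∃ w : ℕ → X, ∀ k, w k = v k - (f' (x k) + f'' (x k) (y k - x k) +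
      (L k * ‖y k - x k‖ ^ (q - 2)) • (y k - x k)) := ⟨_, fun _ => rfl⟩
  have hu_prox : ∀ k, u k = proxg (y k - (f' (x k) + f'' (x k) (y k - x k) +
      (L k * ‖y k - x k‖ ^ (q - 2)) • (y k - x k))) := fun k => by
    rw [hu, hv, hRk, sub_sub_cancel]
  have hudom : ∀ k, g (u k) ≠ ⊤ := fun k => by rw [hu_prox]; exact (hprox _).1
  have hwsub : ∀ k, w k ∈ ESubdiff g (u k) := fun k => by
    have h := (hprox (y k - (f' (x k) + f'' (x k) (y k - x k) +
      (L k * ‖y k - x k‖ ^ (q - 2)) • (y k - x k)))).2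
    rw [← hu_prox] at h
    convert h using 1
    rw [hw, hu]
    abel
  simp only [← hu] at hxsucc
  have hxdom : ∀ k, g (x k) ≠ ⊤ := by
    rintro (_ | k)
    · exact hx0
    · rw [hxsucc]
      split_ifs
      exacts [hydom k, hudom k]
  -- step lengths and weights
  have hd : ∀ k, 0 < ‖y k - x k‖ := fun k => by
    rw [norm_pos_iff, sub_ne_zero]
    intro h
    have := hinex2 k
    rw [h] at this
    exact lt_irrefl _ this
  have hLge : ∀ k, Lmin ≤ L k := fun k => by
    rw [hLdef]
    have h1 := one_le_pow₀ (n := j k) hτ.le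
    have h2 := (hL0 k).1
    nlinarith
  -- descent in real form
  have hdescR : ∀ k, f (y k) + (g (y k)).toReal ≤
      f (x k) + (g (x k)).toReal - σ * L k / q * ‖y k - x k‖ ^ q := fun k => by
    have h := hdesc k
    rw [hFr _ (hydom k), hFr _ (hxdom k)] at h
    exact_mod_cast h
  have hFsucc_y : ∀ k, f (x (k + 1)) + (g (x (k + 1))).toReal ≤
      f (y k) + (g (y k)).toReal := fun k => by
    rw [hxsucc]
    split_ifs with h
    · exact le_rfl
    · rw [hFr _ (hydom k), hFr _ (hudom k), not_lt] at h
      exact_mod_cast h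
  have hFsucc_u : ∀ k, f (x (k + 1)) + (g (x (k + 1))).toReal ≤
      f (u k) + (g (u k)).toReal := fun k => by
    rw [hxsucc]
    split_ifs with h
    · rw [hFr _ (hydom k), hFr _ (hudom k)] at h
      exact_mod_cast h.le
    · exact le_rfl
  obtain ⟨Fx, hFx⟩ : ∃ Fx : ℕ → ℝ, ∀ k, Fx k = f (x k) + (g (x k)).toReal := ⟨_, fun _ => rfl⟩
  simp only [← hFx] at hdescR hFsucc_y hFsucc_u
  have hc : 0 < σ * Lmin / q := div_pos (mul_pos hσ.1 hLmin) hq0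
  have hdesc' : ∀ k, σ * Lmin / q * ‖y k - x k‖ ^ q ≤ Fx k - Fx (k + 1) := fun k => by
    have h1 : σ * Lmin / q ≤ σ * L k / q := by
      have := hσ.1
      have := hLge k
      gcongr
    have h2 := mul_le_mul_of_nonneg_right h1 (Real.rpow_nonneg (norm_nonneg (y k - x k)) q)
    linarith [hdescR k, hFsucc_y k]
  have hanti : Antitone Fx := antitone_nat_of_succ_le fun k => by
    have := mul_pos hc (Real.rpow_pos_of_pos (hd k) q)
    linarith [hdesc' k]
  have hbdd : BddBelow (Set.range Fx) := by
    obtain ⟨m, hm⟩ := hFbdd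
    refine ⟨m, ?_⟩
    rintro _ ⟨k, rfl⟩
    have h := hm (x k)
    rw [hFr _ (hxdom k), ← hFx] at h
    exact_mod_cast h
  obtain ⟨Fs, hFs⟩ : ∃ Fs, Tendsto Fx atTop (𝓝 Fs) := ⟨_, tendsto_atTop_ciInf hanti hbdd⟩
  have hdlim : Tendsto (fun k => ‖y k - x k‖) atTop (𝓝 0) := by
    have h1 : Tendsto (fun k => (Fx k - Fx (k + 1)) / (σ * Lmin / q)) atTop (𝓝 0) := by
      have := (hFs.sub ((tendsto_add_atTop_iff_nat 1).2 hFs)).div_const (σ * Lmin / q)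
      rwa [sub_self, zero_div] at this
    have h2 : Tendsto (fun k => ‖y k - x k‖ ^ q) atTop (𝓝 0) :=
      squeeze_zero (fun k => Real.rpow_nonneg (norm_nonneg _) _)
        (fun k => by rw [le_div_iff₀' hc]; exact hdesc' k) h1
    have h3 := h2.rpow_const (p := q⁻¹) (Or.inr (inv_nonneg.2 hq0.le))
    rw [Real.zero_rpow (inv_ne_zero hq0.ne')] at h3
    exact h3.congr fun k => Real.rpow_rpow_inv (norm_nonneg _) hq0.ne'
  have hxbdd : Bornology.IsBounded (Set.range x) := hlevel.subset <| by
    rintro _ ⟨k, rfl⟩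
    change F (x k) ≤ F (x 0)
    rw [hFr _ (hxdom k), hFr _ (hxdom 0), ← hFx, ← hFx]
    exact_mod_cast hanti (Nat.zero_le k)
  -- cluster points lie in the domain
  have hcluster_dom : ∀ z, MapClusterPt z atTop x → g z ≠ ⊤ := fun z hz => by
    have hzN : z ∈ N := hNomega hz
    obtain ⟨K, hK, δ, hδ, hlip⟩ := hHloc z hzN
    obtain ⟨ε, hε, hεN⟩ := Metric.isOpen_iff.1 hNopen z hzN
    refine ne_top_of_mapClusterPt hgnebot hglsc hD hf1D hf2D hxdom (B := Fx 0)
      (fun k => by rw [← hFx]; exact hanti (Nat.zero_le k)) hz (lt_min hδ hε)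
      (K := ‖f'' z‖ + K * δ) fun a ha => ?_
    have ha1 : dist a z < min δ ε := ha
    have ha2 : ‖a - z‖ ≤ δ := by
      rw [← dist_eq_norm]; exact (ha1.trans_le (min_le_left _ _)).le
    have h1 := hlip a ⟨ha1.trans_le (min_le_left _ _), hεN (ha1.trans_le (min_le_right _ _))⟩ z
      ⟨Metric.mem_ball_self hδ, hzN⟩
    have h2 := norm_le_norm_add_norm_sub' (f'' a) (f'' z)
    have h3 := mul_le_mul_of_nonneg_left ha2 hK.le
    linarith
  have hcont : ∀ z, g z ≠ ⊤ → ContinuousAt f z ∧ ContinuousAt f' z ∧ ContinuousAt f'' z :=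
    fun z hz => ⟨(hf1D z hz).hasFDerivAt.continuousAt, (hf2D z hz).continuousAt,
      hf2c.continuousAt (hO.mem_nhds (hOdom hz))⟩
  obtain ⟨C, hC⟩ : ∃ C, ∀ᶠ k in atTop, LocalControl g f f' f'' C (x k) := by
    refine exists_eventually_of_mapClusterPt hxbdd
      (P := fun C k => LocalControl g f f' f'' C (x k)) max
      (fun a b k h => h.mono (le_max_left _ _)) (fun a b k h => h.mono (le_max_right _ _))
      fun z hz => ?_
    have hzD := hcluster_dom z hz
    obtain ⟨K, -, δ, hδ, hlip⟩ := hHloc z (hNomega hz)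
    obtain ⟨U, hU, C, hC⟩ := exists_nhds_localControl (g := g) (hcont z hzD).1 (hcont z hzD).2.1
      (hcont z hzD).2.2 (hNopen.mem_nhds (hNomega hz)) hδ hlip
    exact ⟨U, hU, C, Eventually.of_forall fun k hk => hC _ hk⟩
  have hC1 : 1 ≤ C := hC.exists.choose_spec.one_le
  have hC0 : 0 < C := by linarith
  -- the weights are eventually bounded
  obtain ⟨M, hM⟩ : ∃ M, ∀ᶠ k in atTop, L k ≤ M := by
    obtain ⟨R, hR⟩ := hxbdd.exists_norm_le
    set p := proxg 0
    have hR0 : 0 ≤ R := (norm_nonneg _).trans (hR _ ⟨0, rfl⟩)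
    set A := |Fx 0| + C + |(g p).toReal| + ‖p‖ * (1 + R + ‖p‖) with hAdef
    have hA : 0 ≤ A := by positivity
    have hmin : ∀ k b, g b ≠ ⊤ → -(A * (1 + ‖b - x k‖)) ≤ (g b).toReal := fun k b hb => by
      have h1 := (mem_eSubdiff_iff_toReal hgnebot (hprox 0).1).1 (hprox 0).2 b hb
      have h2 := abs_real_inner_le_norm (0 - p) (b - p)
      have h3 : ‖b - p‖ ≤ ‖b - x k‖ + (R + ‖p‖) := by
        have h4 := hR _ ⟨k, rfl⟩
        have h5 := norm_sub_le (x k) p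
        have h6 := norm_add_le (b - x k) (x k - p)
        rw [sub_add_sub_cancel] at h6
        linarith
      rw [zero_sub, norm_neg] at h2
      rw [zero_sub] at h1
      have h4 := mul_le_mul_of_nonneg_left h3 (norm_nonneg p)
      have h5 := neg_abs_le ⟪-p, b - p⟫_ℝ
      have h6 := neg_abs_le (g p).toReal
      have h7 := abs_nonneg (Fx 0)
      have h8 := abs_nonneg (g p).toReal
      have h9 := norm_nonneg (b - x k)
      have h10 := norm_nonneg p
      have h11 : 0 ≤ (|Fx 0| + C + |(g p).toReal| + ‖p‖ * (R + ‖p‖)) * ‖b - x k‖ := by positivity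
      have h12 : A * (1 + ‖b - x k‖) = |Fx 0| + C + |(g p).toReal| + ‖p‖ * (1 + R + ‖p‖) +
        ‖p‖ * ‖b - x k‖ +
        (|Fx 0| + C + |(g p).toReal| + ‖p‖ * (R + ‖p‖)) * ‖b - x k‖ := by rw [hAdef]; ring
      change (g p).toReal + ⟪-p, b - p⟫_ℝ ≤ _ at h1
      rw [h12]
      linarith
    refine ⟨max Lmax (τ * (3 * (2 * A + C) * q * C ^ 3 + C * q / (1 - σ))), hC.mono fun k hk => ?_⟩
    rcases Nat.eq_zero_or_pos (j k) with hj | hj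
    · refine le_max_of_le_left ?_
      rw [hLdef, hj, pow_zero, one_mul]
      exact (hL0 k).2
    · refine le_max_of_le_right ?_
      obtain ⟨b, hb, -, hmodel, hfail⟩ := hback k hj
      have hga : (g (x k)).toReal ≤ A := by
        have h1 := hanti (Nat.zero_le k)
        have h2 := hk.lower
        have h3 := le_abs_self (Fx 0)
        have h4 := abs_nonneg (g p).toReal
        have h5 : 0 ≤ ‖p‖ * (1 + R + ‖p‖) := by positivity
        rw [hFx k] at h1
        linarith
      rw [hΘ, hΘ, ← EReal.coe_toReal hb (hgnebot b),
        ← EReal.coe_toReal (hxdom k) (hgnebot (x k)), ← EReal.coe_add, ← EReal.coe_add,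
        EReal.coe_lt_coe_iff, hϑ, hϑ] at hmodel
      simp only [sub_self, inner_zero_right, map_zero, norm_zero, Real.zero_rpow hq0.ne',
        mul_zero, add_zero] at hmodel
      rw [hFr _ hb, hFr _ (hxdom k)] at hfail
      have hfail' : f (x k) + (g (x k)).toReal - σ * (L k / τ) / q * ‖b - x k‖ ^ q <
        f b + (g b).toReal := by exact_mod_cast hfail
      have := hk.weight_le_of_descent_fails hD hf1D hf2D (hxdom k) hb hA hq2 hq3 hσ.2
        (hmin k b hb) hga (by linarith) hfail'
      rwa [div_le_iff₀' (by linarith)] at this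
  have hM0 : 0 ≤ M := by
    obtain ⟨k, hk⟩ := hM.exists
    linarith [hLge k]
  -- asymptotic estimates
  have hv_le : ∀ᶠ k in atTop, ‖v k‖ ≤ M * ‖y k - x k‖ ^ (q - 1) := by
    filter_upwards [hM] with k hk
    rw [hv]
    refine (hinex1 k).trans (mul_le_mul_of_nonneg_right ?_ (by positivity))
    have h1 : 0 ≤ L k := by linarith [hLge k]
    have h2 := mul_le_mul_of_nonneg_right hϱ.2.le h1
    linarith
  have hd1 : ∀ᶠ k in atTop, ‖y k - x k‖ < 1 := hdlim.eventually (gt_mem_nhds one_pos)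
  have hpow_le : ∀ᶠ k in atTop, ‖y k - x k‖ ^ (q - 1) ≤ ‖y k - x k‖ := by
    filter_upwards [hd1] with k hk
    conv_rhs => rw [← Real.rpow_one ‖y k - x k‖]
    exact Real.rpow_le_rpow_of_exponent_ge (hd k) hk.le (by linarith)
  have hv_le' : ∀ᶠ k in atTop, ‖v k‖ ≤ M * ‖y k - x k‖ := by
    filter_upwards [hv_le, hpow_le] with k h1 h2
    exact h1.trans (mul_le_mul_of_nonneg_left h2 hM0)
  have hux : ∀ᶠ k in atTop, ‖u k - x k‖ ≤ (1 + M) * ‖y k - x k‖ := by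
    filter_upwards [hv_le'] with k hk
    have h1 : u k - x k = (y k - x k) - v k := by rw [hu]; abel
    rw [h1]
    linarith [norm_sub_le (y k - x k) (v k)]
  have hdmul : ∀ B : ℝ, Tendsto (fun k => B * ‖y k - x k‖) atTop (𝓝 0) := fun B => by
    simpa using hdlim.const_mul B
  have hux_lt : ∀ᶠ k in atTop, ‖u k - x k‖ < 1 / C := by
    filter_upwards [hux, (hdmul (1 + M)).eventually (gt_mem_nhds (one_div_pos.2 hC0))]
      with k h1 h2 using h1.trans_lt h2
  have hyx_lt : ∀ᶠ k in atTop, ‖y k - x k‖ < 1 / C :=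
    hdlim.eventually (gt_mem_nhds (one_div_pos.2 hC0))
  have huxlim : Tendsto (fun k => u k - x k) atTop (𝓝 0) :=
    squeeze_zero_norm' hux (hdmul _)
  set Q := C * (1 + M) ^ 2 + C * M + 2 * M with hQ
  have hQ0 : 0 ≤ Q := by positivity
  have hres : ∀ᶠ k in atTop, ‖f' (u k) + w k‖ ≤ Q * ‖y k - x k‖ ^ (q - 1) := by
    filter_upwards [hC, hM, hv_le, hd1, hux_lt] with k h1 h2 h3 h4 h5
    have hudk := hudom k
    rw [hu] at h5 hudk
    rw [hu, hw]
    exact h1.norm_grad_add_subgrad_le hD hf2D (hxdom k) hudk hq2 hq3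
      (by linarith [hLge k]) h2 (hd k) h4.le h3 h5
  have hreslim : Tendsto (fun k => f' (u k) + w k) atTop (𝓝 0) := by
    refine squeeze_zero_norm' ?_ (hdmul Q)
    filter_upwards [hres, hpow_le] with k h1 h2
    exact h1.trans (mul_le_mul_of_nonneg_left h2 hQ0)
  have hw_le : ∀ᶠ k in atTop, ‖w k‖ ≤ 2 * M + 2 * C := by
    filter_upwards [hC, hM, hv_le', hd1, hpow_le] with k h1 h2 h3 h4 h5
    have e1 : ‖f'' (x k) (y k - x k)‖ ≤ C * ‖y k - x k‖ := (f'' (x k)).le_of_opNorm_le h1.hess _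
    have e2 : ‖(L k * ‖y k - x k‖ ^ (q - 2)) • (y k - x k)‖ ≤ M * ‖y k - x k‖ := by
      have hL : 0 ≤ L k := by linarith [hLge k]
      rw [norm_smul, Real.norm_of_nonneg (by positivity)]
      have e3 : ‖y k - x k‖ ^ (q - 2) ≤ 1 := Real.rpow_le_one (norm_nonneg _) h4.le (by linarith)
      have e4 : L k * ‖y k - x k‖ ^ (q - 2) ≤ M * 1 := mul_le_mul h2 e3 (by positivity) hM0
      rw [mul_one] at e4
      exact mul_le_mul_of_nonneg_right e4 (norm_nonneg _)
    rw [hw]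
    have e5 := norm_sub_le (v k) (f' (x k) + f'' (x k) (y k - x k) +
      (L k * ‖y k - x k‖ ^ (q - 2)) • (y k - x k))
    have e6 := norm_add_le (f' (x k) + f'' (x k) (y k - x k))
      ((L k * ‖y k - x k‖ ^ (q - 2)) • (y k - x k))
    have e7 := norm_add_le (f' (x k)) (f'' (x k) (y k - x k))
    have e8 := h1.grad
    have e9 : M * ‖y k - x k‖ ≤ M * 1 := mul_le_mul_of_nonneg_left h4.le hM0
    have e10 : C * ‖y k - x k‖ ≤ C * 1 := mul_le_mul_of_nonneg_left h4.le hC0.le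
    linarith
  obtain ⟨Fu, hFu⟩ : ∃ Fu : ℕ → ℝ, ∀ k, Fu k = f (u k) + (g (u k)).toReal := ⟨_, fun _ => rfl⟩
  simp only [← hFu] at hFsucc_u
  have hFulim : Tendsto Fu atTop (𝓝 Fs) := by
    have hupper : ∀ᶠ k in atTop, Fu k ≤ Fx k +
        (3 * C * (1 + M) + 3 * C + (2 * M + 2 * C) * M) * ‖y k - x k‖ := by
      filter_upwards [hC, hv_le', hux, hux_lt, hyx_lt, hw_le] with k h1 h2 h3 h4 h5 h6
      have e1 := h1.abs_sub_le hD hf1D hf2D (hxdom k) (hudom k) h4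
      have e2 := h1.abs_sub_le hD hf1D hf2D (hxdom k) (hydom k) h5
      have e3 := (mem_eSubdiff_iff_toReal hgnebot (hudom k)).1 (hwsub k) (y k) (hydom k)
      have e4 : y k - u k = v k := by rw [hu]; abel
      rw [e4] at e3
      have e5 := abs_real_inner_le_norm (w k) (v k)
      have e6 : ‖w k‖ * ‖v k‖ ≤ (2 * M + 2 * C) * (M * ‖y k - x k‖) :=
        mul_le_mul h6 h2 (norm_nonneg _) (by positivity)
      have e7 : 3 * C * ‖u k - x k‖ ≤ 3 * C * ((1 + M) * ‖y k - x k‖) :=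
        mul_le_mul_of_nonneg_left h3 (by positivity)
      have e8 := hdescR k
      have e9 : 0 ≤ σ * L k / q * ‖y k - x k‖ ^ q := by
        have := hσ.1
        have : 0 ≤ L k := by linarith [hLge k]
        positivity
      rw [hFu]
      linarith [neg_abs_le ⟪w k, v k⟫_ℝ, le_abs_self (f (u k) - f (x k)),
        neg_abs_le (f (y k) - f (x k))]
    refine tendsto_of_tendsto_of_tendsto_of_le_of_le'
      ((tendsto_add_atTop_iff_nat 1).2 hFs) ?_ (Eventually.of_forall hFsucc_u) hupper
    simpa using hFs.add (hdmul (3 * C * (1 + M) + 3 * C + (2 * M + 2 * C) * M))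
  -- cluster points are stationary with the limiting objective value
  have hcluster : ∀ z, MapClusterPt z atTop x → -f' z ∈ ESubdiff g z ∧ F z = (Fs : EReal) := by
    intro z hz
    have hzD := hcluster_dom z hz
    obtain ⟨ψ, hψ, hxψ⟩ := hz.tendsto_subseq
    have huψ : Tendsto (fun n => u (ψ n)) atTop (𝓝 z) := by
      simpa using hxψ.add (huxlim.comp hψ.tendsto_atTop)
    have hwψ : Tendsto (fun n => w (ψ n)) atTop (𝓝 (-f' z)) := by
      simpa using (hreslim.comp hψ.tendsto_atTop).sub ((hcont z hzD).2.1.tendsto.comp huψ)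
    obtain ⟨-, h1, h2⟩ := eSubdiff_closed_graph hgnebot hgproper hglsc (fun n => hudom (ψ n))
      (fun n => hwsub (ψ n)) huψ hwψ
    refine ⟨h1, ?_⟩
    have h3 := ((hcont z hzD).1.tendsto.comp huψ).add h2
    have h4 := tendsto_nhds_unique h3
      ((hFulim.comp hψ.tendsto_atTop).congr fun n => hFu (ψ n))
    rw [hFr z hzD, h4]
  have hsum : Summable fun k => ‖y k - x k‖ := by
    refine summable_of_descent_of_KL hxbdd (q := q) (by linarith) hc hQ0 hd hdesc' hFsucc_u hFs
      hFulim (by simpa [dist_eq_norm] using huxlim.norm) fun z hz => ?_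
    obtain ⟨hstat, hFz⟩ := hcluster z hz
    obtain ⟨δ, hδ, ϖ, hϖ, φ, φd, -, -, hconc, hder, -, hineq⟩ := hKL z ⟨_, hstat⟩
    obtain ⟨ϖ₀, hϖ₀, hϖ₁⟩ := EReal.lt_iff_exists_real_btwn.1 hϖ
    have hϖ₀' : 0 < ϖ₀ := by exact_mod_cast hϖ₀
    have hlt : ∀ t : ℝ, t < ϖ₀ → (t : EReal) < ϖ := fun t ht =>
      lt_trans (by exact_mod_cast ht) hϖ₁
    refine ⟨δ, hδ, ϖ₀, hϖ₀', φ, φd, hconc.subset (fun t ht => ⟨ht.1, hlt t ht.2⟩)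
      (convex_Ico 0 ϖ₀), fun t ht => hder t ht.1 (hlt t ht.2), ?_⟩
    filter_upwards [hres] with k hk h1 h2 h3
    have hFuk : F (u k) = (Fu k : EReal) := by rw [hFr _ (hudom k), hFu]
    have h4 := hineq (u k) h1 (by rw [hFz, hFuk]; exact_mod_cast h2)
      (by
        rw [hFz, hFuk]
        refine lt_of_lt_of_le ?_ (add_le_add_right hϖ₁.le _)
        exact_mod_cast h3) (w k) (hwsub k)
    rw [hFz, hFuk, ← EReal.coe_sub, EReal.toReal_coe] at h4
    have h5 := (hder (Fu k - Fs) (by linarith) (hlt _ (by linarith))).2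
    exact h4.trans (mul_le_mul_of_nonneg_left hk h5.le)
  have hsteps : Summable fun k => ‖x (k + 1) - x k‖ := by
    refine Summable.of_norm_bounded_eventually_nat (hsum.mul_left (1 + M)) ?_
    filter_upwards [hux] with k hk
    rw [norm_norm, hxsucc]
    split_ifs
    · linarith [mul_nonneg hM0 (norm_nonneg (y k - x k))]
    · exact hk
  refine ⟨hsteps, ?_⟩
  have hcauchy : CauchySeq x := cauchySeq_of_summable_dist
    (hsteps.congr fun k => by rw [dist_comm, dist_eq_norm])
  obtain ⟨xb, hxb⟩ := cauchySeq_tendsto_of_complete hcauchy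
  exact ⟨xb, (hcluster xb hxb.mapClusterPt).1, hxb⟩
end
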